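/- arXiv:2307.16306 — 3 statements merged into one kernel-verified Lean document; each statement's English description precedes it below -/
import Mathlib

section
/- For every positive integer d there exists a constant C(d) > 0 such that every d-dimensional weakly sporadic F-hollow lattice polytope P ⊆ ℝ^d has Lebesgue volume vol(P) < C(d). -/
open Set MeasureTheory

noncomputable section

/-- The real vector corresponding to an integer vector. -/
def intVec {d : ℕ} (ν : Fin d → ℤ) : Fin d → ℝ := fun i => (ν i : ℝ)

/-- The standard inner product on `ℝ^d`. -/
def dotR {d : ℕ} (x y : Fin d → ℝ) : ℝ := ∑ i, x i * y i

/-- `Min_P(ν) = min_{x ∈ P} ⟨x, ν⟩`. -/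
def MinP {d : ℕ} (P : Set (Fin d → ℝ)) (ν : Fin d → ℝ) : ℝ :=
  sInf ((fun x => dotR x ν) '' P)

/-- The set of lattice points of `ℝ^d`. -/
def latticePts (d : ℕ) : Set (Fin d → ℝ) := Set.range intVec

/-- The set of rational points of `ℝ^d`. -/
def ratPts (d : ℕ) : Set (Fin d → ℝ) := {x | ∀ i, ∃ q : ℚ, x i = (q : ℝ)}

/-- The Fine interior of `P`. -/
def fineInt {d : ℕ} (P : Set (Fin d → ℝ)) : Set (Fin d → ℝ) :=
  {x | ∀ ν : Fin d → ℤ, ν ≠ 0 → MinP P (intVec ν) + 1 ≤ dotR x (intVec ν)}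

/-- A lattice polytope: the convex hull of a finite set of lattice points. -/
def IsLatticePolytope {d : ℕ} (P : Set (Fin d → ℝ)) : Prop :=
  ∃ A : Finset (Fin d → ℝ), ↑A ⊆ latticePts d ∧ P = convexHull ℝ (A : Set (Fin d → ℝ))

/-- A rational polytope: the convex hull of a finite set of rational points. -/
def IsRatPolytope {d : ℕ} (P : Set (Fin d → ℝ)) : Prop :=
  ∃ A : Finset (Fin d → ℝ), ↑A ⊆ ratPts d ∧ P = convexHull ℝ (A : Set (Fin d → ℝ))

/-- A subset of `ℝ^d` is full-dimensional if its affine span is everything. -/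
def IsFullDim {d : ℕ} (P : Set (Fin d → ℝ)) : Prop := affineSpan ℝ P = ⊤

/-- `P` is F-hollow if its Fine interior is empty. -/
def FHollow {d : ℕ} (P : Set (Fin d → ℝ)) : Prop := fineInt P = ∅

/-- The dilation `λP = {λx : x ∈ P}`. -/
def dilate {d : ℕ} (lam : ℝ) (P : Set (Fin d → ℝ)) : Set (Fin d → ℝ) :=
  (fun x => lam • x) '' P

/-- The minimal multiplier `μ(P)`. -/
def minMult {d : ℕ} (P : Set (Fin d → ℝ)) : ℝ :=
  sInf {lam : ℝ | 0 < lam ∧ (fineInt (dilate lam P)).Nonempty}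

/-- Unimodular equivalence of subsets of `ℝ^d`. -/
def UnimodEquiv {d : ℕ} (P₁ P₂ : Set (Fin d → ℝ)) : Prop :=
  ∃ φ : (Fin d → ℝ) ≃ᵃ[ℝ] (Fin d → ℝ),
    φ '' latticePts d = latticePts d ∧ φ '' P₁ = P₂

/-- An affine map `ℝ^d → ℝ^k` inducing a surjection of lattices. -/
def IsLatticeProj {d k : ℕ} (π : (Fin d → ℝ) →ᵃ[ℝ] (Fin k → ℝ)) : Prop :=
  π '' latticePts d = latticePts k

/-- A sporadic F-hollow lattice polytope: a full-dimensional F-hollow lattice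
polytope admitting no lattice projection onto a lower-dimensional F-hollow
lattice polytope. -/
def IsSporadic {d : ℕ} (P : Set (Fin d → ℝ)) : Prop :=
  IsLatticePolytope P ∧ IsFullDim P ∧ FHollow P ∧
  ¬ ∃ (k : ℕ) (_ : 1 ≤ k) (_ : k ≤ d - 1) (π : (Fin d → ℝ) →ᵃ[ℝ] (Fin k → ℝ)),
      IsLatticeProj π ∧ IsLatticePolytope (π '' P) ∧ IsFullDim (π '' P) ∧
      FHollow (π '' P)

/-- A weakly sporadic F-hollow lattice polytope: a full-dimensional F-hollow
lattice polytope `P` such that `F(μ(P)·P)` is a single point. -/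
def IsWeaklySporadic {d : ℕ} (P : Set (Fin d → ℝ)) : Prop :=
  IsLatticePolytope P ∧ IsFullDim P ∧ FHollow P ∧
  ∃ p : Fin d → ℝ, fineInt (dilate (minMult P) P) = {p}

/-- The support `S_F(P)` of the Fine interior of `P`. -/
def suppF {d : ℕ} (P : Set (Fin d → ℝ)) : Set (Fin d → ℤ) :=
  {ν | MinP (fineInt P) (intVec ν) = MinP P (intVec ν) + 1}

/-- The dimension of the affine span of a set. -/
def aDim {d : ℕ} (S : Set (Fin d → ℝ)) : ℕ :=
  Module.finrank ℝ (affineSpan ℝ S).direction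

/-- Lebesgue volume of a subset of `ℝ^d`, as a real number. -/
def vol {d : ℕ} (S : Set (Fin d → ℝ)) : ℝ := (volume S).toReal

theorem exists_nat_simultaneous_approx {ι : Type*} [Fintype ι] (β : ι → ℝ) {M : ℕ} (hM : 0 < M) :
    ∃ q : ℕ, 0 < q ∧ q ≤ M ^ Fintype.card ι ∧
      ∃ a : ι → ℤ, ∀ i, |q * β i - a i| ≤ 1 / M := by
  classical
  have hM' : (0 : ℝ) < M := by exact_mod_cast hM
  have hlt (n : ℕ) (i : ι) : ⌊Int.fract (n * β i) * M⌋₊ < M := by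
    rw [Nat.floor_lt (by positivity)]
    exact mul_lt_of_lt_one_left hM' (Int.fract_lt_one _)
  let f : ℕ → ι → Fin M := fun n i => ⟨⌊Int.fract (n * β i) * M⌋₊, hlt n i⟩
  obtain ⟨x, hx, y, hy, hne, hf⟩ := Finset.exists_ne_map_eq_of_card_lt_of_maps_to
    (s := Finset.range (M ^ Fintype.card ι + 1)) (t := Finset.univ) (f := f)
    (by simp) (fun _ _ => Finset.mem_coe.2 (Finset.mem_univ _))
  wlog hxy : x < y generalizing x y
  · exact this y hy x hx hne.symm hf.symm (by omega)
  refine ⟨y - x, by omega, by simp at hy; omega,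
    fun i => ⌊y * β i⌋ - ⌊x * β i⌋, fun i => ?_⟩
  have h := congrArg Fin.val (congrFun hf i)
  simp only [f] at h
  have h1 := Nat.floor_le (show 0 ≤ Int.fract (x * β i) * M by positivity)
  have h2 := Nat.lt_floor_add_one (Int.fract (x * β i) * M)
  have h3 := Nat.floor_le (show 0 ≤ Int.fract (y * β i) * M by positivity)
  have h4 := Nat.lt_floor_add_one (Int.fract (y * β i) * M)
  rw [h] at h1 h2
  have e : ((y - x : ℕ) : ℝ) * β i - ((⌊y * β i⌋ - ⌊x * β i⌋ : ℤ) : ℝ)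
      = Int.fract (y * β i) - Int.fract (x * β i) := by
    rw [Nat.cast_sub hxy.le, Int.fract, Int.fract]
    push_cast
    ring
  rw [e, abs_le, neg_le, le_div_iff₀ hM', le_div_iff₀ hM']
  constructor <;> linarith

/-- Carathéodory's theorem for conical combinations. -/
theorem exists_linearIndepOn_conic_combination {E : Type*} [AddCommGroup E] [Module ℝ E]
    (T : Finset E) (a : E → ℝ) (ha : ∀ v ∈ T, 0 ≤ a v) :
    ∃ T' ⊆ T, ∃ b : E → ℝ, LinearIndepOn ℝ id (T' : Set E) ∧ (∀ v ∈ T', 0 < b v) ∧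
      ∑ v ∈ T', b v • v = ∑ v ∈ T, a v • v := by
  classical
  induction hn : T.card generalizing T a with
  | zero =>
    obtain rfl := Finset.card_eq_zero.1 hn
    exact ⟨∅, subset_rfl, a, by simp, by simp, rfl⟩
  | succ n ih =>
    have reduce (b : E → ℝ) (hb : ∀ v ∈ T, 0 ≤ b v) (w : E) (hw : w ∈ T) (hbw : b w = 0)
        (hsum : ∑ v ∈ T, b v • v = ∑ v ∈ T, a v • v) :
        ∃ T' ⊆ T, ∃ b : E → ℝ, LinearIndepOn ℝ id (T' : Set E) ∧ (∀ v ∈ T', 0 < b v) ∧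
          ∑ v ∈ T', b v • v = ∑ v ∈ T, a v • v := by
      obtain ⟨T', hT', c, h1, h2, h3⟩ := ih (T.erase w) b
        (fun v hv => hb v (Finset.mem_of_mem_erase hv)) (by rw [Finset.card_erase_of_mem hw, hn]; rfl)
      refine ⟨T', hT'.trans (Finset.erase_subset _ _), c, h1, h2, ?_⟩
      rw [h3, ← hsum, ← Finset.add_sum_erase T _ hw, hbw, zero_smul, zero_add]
    by_cases hz : ∃ v ∈ T, a v = 0
    · obtain ⟨w, hw, h0⟩ := hz
      exact reduce a ha w hw h0 rfl
    push Not at hz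
    by_cases hli : LinearIndepOn ℝ id (T : Set E)
    · exact ⟨T, subset_rfl, a, hli, fun v hv => lt_of_le_of_ne (ha v hv) (hz v hv).symm, rfl⟩
    obtain ⟨g, hg, w, hw, hgw⟩ : ∃ g : E → ℝ, ∑ v ∈ T, g v • v = 0 ∧ ∃ w ∈ T, 0 < g w := by
      rw [linearIndepOn_finset_iff] at hli
      push Not at hli
      obtain ⟨g, hg, w, hw, hgw⟩ := hli
      rcases lt_or_gt_of_ne hgw with h | h
      · refine ⟨-g, by simpa using hg, w, hw, by simpa using h⟩
      · exact ⟨g, by simpa using hg, w, hw, h⟩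
    obtain ⟨u, hu, hmin⟩ := Finset.exists_min_image (T.filter fun v => 0 < g v)
      (fun v => a v / g v) ⟨w, by simp [hw, hgw]⟩
    simp only [Finset.mem_filter] at hu hmin
    refine reduce (fun v => a v - a u / g u * g v) (fun v hv => ?_) u hu.1 ?_ ?_
    · have h0 : 0 ≤ a u / g u := div_nonneg (ha u hu.1) hu.2.le
      rcases le_or_gt (g v) 0 with h | h
      · have := ha v hv
        nlinarith
      · have := hmin v ⟨hv, h⟩
        rw [le_div_iff₀ h] at this
        linarith
    · have := hu.2.ne'
      field_simp
      ring
    · simp only [sub_smul, Finset.sum_sub_distrib, mul_smul, ← Finset.smul_sum, hg, smul_zero,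
        sub_zero]

/-- If the only integer vectors close to the line `ℝ β` from the positive side are multiples of
`β`, then the entries of the positive probability vector `β` are bounded below. -/
theorem exists_pos_forall_le_weight (n : ℕ) : ∃ c : ℝ, 0 < c ∧ ∀ (ι : Type) [Fintype ι] (β : ι → ℝ),
    Fintype.card ι ≤ n → (∀ i, 0 < β i) → ∑ i, β i = 1 →
    (∀ (m : ι → ℤ) (s : ℝ), (∀ i, 0 ≤ m i + s * β i) → ∑ i, (m i + s * β i) < 1 →
      ∃ t : ℝ, ∀ i, (m i : ℝ) = t * β i) →
    ∀ i, c ≤ β i := by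
  classical
  suffices h : ∀ l : ℕ, ∃ c : ℝ, 0 < c ∧ ∀ (ι : Type) [Fintype ι] (β : ι → ℝ),
      Fintype.card ι ≤ n → (∀ i, 0 < β i) → ∑ i, β i = 1 →
      (∀ (m : ι → ℤ) (s : ℝ), (∀ i, 0 ≤ m i + s * β i) → ∑ i, (m i + s * β i) < 1 →
        ∃ t : ℝ, ∀ i, (m i : ℝ) = t * β i) →
      (∀ i, c ≤ β i) ∨ l + 1 ≤ (Finset.univ.filter fun i => c ≤ β i).card by
    obtain ⟨c, hc, H⟩ := h n
    refine ⟨c, hc, fun ι _ β h1 h2 h3 h4 => ?_⟩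
    rcases H ι β h1 h2 h3 h4 with h | h
    · exact h
    · have := Finset.card_le_univ (Finset.univ.filter fun i => c ≤ β i)
      omega
  intro l
  induction l with
  | zero =>
    refine ⟨1 / (n + 1), by positivity, fun ι _ β h1 h2 h3 _ => Or.inr ?_⟩
    rw [zero_add, Nat.one_le_iff_ne_zero, Finset.card_ne_zero]
    by_contra hne
    rw [Finset.not_nonempty_iff_eq_empty, Finset.filter_eq_empty_iff] at hne
    have h5 : ∑ i, β i ≤ ∑ _i : ι, (1 / ((n : ℝ) + 1)) :=
      Finset.sum_le_sum fun i _ => (not_le.1 (hne (Finset.mem_univ i))).le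
    rw [h3, Finset.sum_const, Finset.card_univ, nsmul_eq_mul, mul_one_div,
      le_div_iff₀ (by positivity)] at h5
    have : (Fintype.card ι : ℝ) ≤ n := by exact_mod_cast h1
    linarith
  | succ l ih =>
    obtain ⟨c, hc, H⟩ := ih
    obtain ⟨M, hM⟩ := exists_nat_gt (max (1 / c) (4 * (n + 1 / c)))
    have hM1 : 1 / c < M := (le_max_left _ _).trans_lt hM
    have hM2 : 4 * (n + 1 / c) < M := (le_max_right _ _).trans_lt hM
    have hM0 : (0 : ℝ) < M := lt_trans (by positivity) hM1
    have hMn : 0 < M := by exact_mod_cast hM0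
    have hMc : 1 / (M : ℝ) < c := by
      rw [div_lt_iff₀ hM0]; rw [div_lt_iff₀ hc] at hM1; linarith
    set N : ℝ := (M : ℝ) ^ n + 1 / (M * c) with hN
    have hNpos : 0 < N := by positivity
    refine ⟨min c (1 / (4 * N * (n + 1))), by positivity, fun ι _ β h1 h2 h3 h4 => ?_⟩
    rcases H ι β h1 h2 h3 h4 with h | h
    · exact Or.inl fun i => (min_le_left _ _).trans (h i)
    by_contra! hcon
    obtain ⟨⟨k, hk⟩, hcard⟩ := hcon
    have hsub : (Finset.univ.filter fun i => c ≤ β i) ⊆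
        Finset.univ.filter fun i => min c (1 / (4 * N * (n + 1))) ≤ β i := by
      intro i hi
      simp only [Finset.mem_filter, Finset.mem_univ, true_and] at hi ⊢
      exact (min_le_left _ _).trans hi
    have heq := Finset.eq_of_subset_of_card_le hsub (by omega)
    have hsmall (i : ι) (hi : ¬ c ≤ β i) : β i < 1 / (4 * N * (n + 1)) := by
      have : i ∉ Finset.univ.filter fun i => min c (1 / (4 * N * (n + 1))) ≤ β i := by
        rw [← heq]; simpa using hi
      simp only [Finset.mem_filter, Finset.mem_univ, true_and, min_le_iff, not_or, not_le] at this
      exact this.2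
    have hkc : ¬ c ≤ β k := fun h => absurd (hk.trans_le (min_le_left _ _)) (not_lt.2 h)
    obtain ⟨q, hq0, hqM, a, ha⟩ := exists_nat_simultaneous_approx β hMn
    have hqR : (q : ℝ) ≤ (M : ℝ) ^ n := by
      exact_mod_cast hqM.trans (Nat.pow_le_pow_right hMn h1)
    set s : ℝ := q + 1 / (M * c) with hs
    have hsN : s ≤ N := by rw [hs, hN]; linarith
    have hs0 : 0 < s := by positivity
    let m : ι → ℤ := fun i => if c ≤ β i then - a i else 0
    have hcn : (Fintype.card ι : ℝ) ≤ n := by exact_mod_cast h1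
    have hterm (i : ι) : 0 ≤ m i + s * β i ∧
        m i + s * β i ≤ 1 / M + 1 / (M * c) * β i + 1 / (4 * (n + 1)) := by
      have hβ := h2 i
      by_cases hi : c ≤ β i
      · have hai := abs_le.1 (ha i)
        have : 1 / (M : ℝ) ≤ 1 / (M * c) * β i := by
          rw [div_mul_eq_mul_div, one_mul, div_le_div_iff₀ hM0 (by positivity)]
          nlinarith
        have h4n : (0 : ℝ) < 1 / (4 * (n + 1)) := by positivity
        simp only [m, hi, if_true, Int.cast_neg, hs, add_mul]
        constructor <;> linarith
      · have hsm := hsmall i hi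
        simp only [m, hi, if_false, Int.cast_zero, zero_add]
        refine ⟨by positivity, ?_⟩
        have : s * β i ≤ 1 / (4 * (n + 1)) := by
          calc s * β i ≤ N * (1 / (4 * N * (n + 1))) := by gcongr
            _ = 1 / (4 * (n + 1)) := by field_simp
        have : 0 < 1 / (M : ℝ) + 1 / (M * c) * β i := by positivity
        linarith
    obtain ⟨t, ht⟩ := h4 m s (fun i => (hterm i).1) <| by
      calc ∑ i, (m i + s * β i)
          ≤ ∑ i, (1 / (M : ℝ) + 1 / (M * c) * β i + 1 / (4 * (n + 1))) :=
            Finset.sum_le_sum fun i _ => (hterm i).2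
        _ = Fintype.card ι * (1 / (M : ℝ)) + 1 / (M * c)
            + Fintype.card ι * (1 / (4 * (n + 1))) := by
            simp [Finset.sum_add_distrib, ← Finset.mul_sum, h3]
        _ ≤ n * (1 / (M : ℝ)) + 1 / (M * c) + n * (1 / (4 * (n + 1))) := by gcongr
        _ = (n + 1 / c) / M + n / (4 * (n + 1)) := by field_simp
        _ ≤ 1 / 4 + 1 / 4 := by
            refine add_le_add ?_ ?_
            · rw [div_le_div_iff₀ hM0 (by norm_num)]; linarith
            · rw [div_le_div_iff₀ (by positivity) (by norm_num)]; linarith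
        _ < 1 := by norm_num
    have ht0 : t = 0 := by
      have := ht k
      simp only [m, hkc, if_false, Int.cast_zero] at this
      rcases mul_eq_zero.1 this.symm with h | h
      · exact h
      · exact absurd h (h2 k).ne'
    obtain ⟨j, hj⟩ : (Finset.univ.filter fun i => c ≤ β i).Nonempty :=
      Finset.card_pos.1 (by omega)
    simp only [Finset.mem_filter, Finset.mem_univ, true_and] at hj
    have haj : (a j : ℝ) = 0 := by
      have := ht j
      simpa [m, hj, ht0] using this
    have h5 := (abs_le.1 (ha j)).2
    rw [haj] at h5
    have : (1 : ℝ) ≤ q := by exact_mod_cast hq0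
    nlinarith [h2 j]

theorem minP_le_dotR {d : ℕ} {Q : Set (Fin d → ℝ)} (hQ : IsCompact Q) {x : Fin d → ℝ} (hx : x ∈ Q)
    (ν : Fin d → ℝ) : MinP Q ν ≤ dotR x ν :=
  csInf_le (hQ.image (by unfold dotR; fun_prop)).bddBelow (mem_image_of_mem _ hx)

theorem le_minP {d : ℕ} {Q : Set (Fin d → ℝ)} (hQ : Q.Nonempty) {ν : Fin d → ℝ} {b : ℝ}
    (h : ∀ x ∈ Q, b ≤ dotR x ν) : b ≤ MinP Q ν :=
  le_csInf (hQ.image _) (forall_mem_image.2 h)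

theorem dotR_eq_dotProduct {d : ℕ} (x y : Fin d → ℝ) : dotR x y = x ⬝ᵥ y := rfl

theorem dotR_comm {d : ℕ} (x y : Fin d → ℝ) : dotR x y = dotR y x := dotProduct_comm x y

theorem dotR_sub {d : ℕ} (x y z : Fin d → ℝ) : dotR (x - y) z = dotR x z - dotR y z :=
  sub_dotProduct x y z

theorem exists_dotR_eq {d : ℕ} (f : (Fin d → ℝ) →ₗ[ℝ] ℝ) :
    ∃ u : Fin d → ℝ, ∀ x, f x = dotR x u :=
  ⟨fun i => f fun j => if i = j then 1 else 0, fun x => by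
    rw [LinearMap.pi_apply_eq_sum_univ f x]; simp [dotR]⟩

theorem eq_zero_of_neg_lt_dotR {d : ℕ} {Q : Set (Fin d → ℝ)} (hQ : Q.Nonempty) {p : Fin d → ℝ}
    (hp : p ∈ fineInt Q) {y : Fin d → ℤ} {σ : ℝ} (hσ : σ < 1)
    (h : ∀ x ∈ Q, -σ ≤ dotR (x - p) (intVec y)) : y = 0 := by
  by_contra hy
  have h1 := hp y hy
  have h2 : dotR p (intVec y) - σ ≤ MinP Q (intVec y) := le_minP hQ fun x hx => by
    have := h x hx
    rw [dotR_sub] at this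
    linarith
  linarith

theorem fineInt_subset_interior {d : ℕ} {Q : Set (Fin d → ℝ)} (hQ : IsCompact Q)
    (hconv : Convex ℝ Q) (hint : (interior Q).Nonempty) : fineInt Q ⊆ interior Q := by
  intro p hp
  by_contra hpi
  have hne : Q.Nonempty := hint.mono interior_subset
  obtain ⟨f, w, hf, hfQ, hfp⟩ := geometric_hahn_banach_of_nonempty_interior hconv
    (convex_singleton p) (disjoint_singleton_right.2 hpi) hint (singleton_nonempty p)
  obtain ⟨u, hu⟩ := exists_dotR_eq (-f : (Fin d → ℝ) →ₗ[ℝ] ℝ)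
  have hu0 : u ≠ 0 := by
    rintro rfl
    refine hf (ContinuousLinearMap.ext fun x => ?_)
    simpa [dotR] using hu x
  obtain ⟨k, hk⟩ := Function.ne_iff.1 hu0
  have hk : 0 < |u k| := abs_pos.2 hk
  have hpos (x) (hx : x ∈ Q) : 0 ≤ dotR (x - p) u := by
    rw [← hu, map_sub]
    have h1 := hfQ x hx
    have h2 := hfp p rfl
    simp
    linarith
  obtain ⟨R, hR⟩ := (hQ.image (continuous_sub_right p)).isBounded.exists_norm_le
  have hR0 : 0 ≤ R := by
    obtain ⟨x, hx⟩ := hne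
    exact (norm_nonneg _).trans (hR _ (mem_image_of_mem _ hx))
  obtain ⟨M, hM⟩ := exists_nat_gt (2 * (d * R) + 2)
  have hdR : 0 ≤ d * R := by positivity
  have hM0 : (0 : ℝ) < M := by linarith
  obtain ⟨q, hq, -, a, ha⟩ := exists_nat_simultaneous_approx (fun i => u i / |u k|)
    (M := M) (by exact_mod_cast hM0)
  have hq1 : (1 : ℝ) ≤ q := by exact_mod_cast hq
  have ha0 : a = 0 := by
    refine eq_zero_of_neg_lt_dotR hne hp (σ := 1 / 2) (by norm_num) fun x hx => ?_
    have hsplit : dotR (x - p) (intVec a) = q / |u k| * dotR (x - p) u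
        - ∑ i, (x - p) i * (q * (u i / |u k|) - a i) := by
      simp only [dotR, intVec, Finset.mul_sum, ← Finset.sum_sub_distrib]
      refine Finset.sum_congr rfl fun i _ => ?_
      ring
    have hsum : ∑ i, (x - p) i * (q * (u i / |u k|) - a i) ≤ ∑ _i : Fin d, R * (1 / M) := by
      refine Finset.sum_le_sum fun i _ => (le_abs_self _).trans ?_
      rw [abs_mul]
      refine mul_le_mul ?_ (ha i) (abs_nonneg _) hR0
      exact (norm_le_pi_norm (x - p) i).trans (hR _ (mem_image_of_mem _ hx))
    have h1 : ∑ _i : Fin d, R * (1 / M) ≤ 1 / 2 := by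
      rw [Finset.sum_const, Finset.card_univ, Fintype.card_fin, nsmul_eq_mul, ← mul_assoc,
        mul_one_div, div_le_div_iff₀ hM0 (by norm_num)]
      linarith
    have h2 : 0 ≤ q / |u k| * dotR (x - p) u := mul_nonneg (by positivity) (hpos x hx)
    linarith
  have hak := ha k
  rw [ha0, Pi.zero_apply, Int.cast_zero, sub_zero, abs_mul, abs_div, abs_abs, div_self hk.ne',
    mul_one, Nat.abs_cast, le_div_iff₀ hM0] at hak
  nlinarith

/-- The lattice normals whose constraint in the definition of the Fine interior of `Q` is tight
at `p`. -/
def tightNormals {d : ℕ} (Q : Set (Fin d → ℝ)) (p : Fin d → ℝ) : Set (Fin d → ℤ) :=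
  {ν | dotR p (intVec ν) ≤ MinP Q (intVec ν) + 1}

theorem finite_setOf_lt_minP_sub {d : ℕ} {Q : Set (Fin d → ℝ)} (hQ : IsCompact Q) {p : Fin d → ℝ}
    (hp : p ∈ interior Q) (b : ℝ) :
    {ν : Fin d → ℤ | b < MinP Q (intVec ν) - dotR p (intVec ν)}.Finite := by
  obtain ⟨r, hr, hball⟩ := Metric.nhds_basis_closedBall.mem_iff.1 (mem_interior_iff_mem_nhds.1 hp)
  obtain ⟨N, hN⟩ := exists_nat_gt (-b / r)
  refine (Set.finite_Icc (fun _ => -(N : ℤ)) fun _ => (N : ℤ)).subset fun ν hν => ?_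
  have key (i : Fin d) (t : ℝ) (ht : |t| = r) : b < t * ν i := by
    have h1 : p + Pi.single i t ∈ Q := hball <| by
      simp [Pi.norm_single, ht]
    have h2 := minP_le_dotR hQ h1 (intVec ν)
    rw [dotR_eq_dotProduct, add_dotProduct, single_dotProduct, ← dotR_eq_dotProduct] at h2
    have h3 : b < MinP Q (intVec ν) - dotR p (intVec ν) := hν
    simp only [intVec] at h2 h3 ⊢
    linarith
  have hN' : -b < N * r := (div_lt_iff₀ hr).1 hN
  refine ⟨fun i => ?_, fun i => ?_⟩
  · have := key i r (abs_of_pos hr)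
    have : -(N : ℝ) ≤ ν i := by nlinarith
    exact_mod_cast this
  · have := key i (-r) (by rw [abs_neg, abs_of_pos hr])
    have : (ν i : ℝ) ≤ N := by nlinarith
    exact_mod_cast this

open Filter Topology in
theorem eq_zero_of_forall_tightNormals {d : ℕ} {Q : Set (Fin d → ℝ)} (hQ : IsCompact Q)
    {p : Fin d → ℝ} (hpi : p ∈ interior Q) (hp : fineInt Q = {p}) {u : Fin d → ℝ}
    (hu : ∀ v ∈ intVec '' tightNormals Q p, 0 ≤ dotR v u) : u = 0 := by
  have hlim (c : ℝ) : Tendsto (fun ε : ℝ => p + (c * ε) • u) (𝓝[>] 0) (𝓝 p) := by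
    have : Continuous fun ε : ℝ => p + (c * ε) • u := by fun_prop
    simpa using (this.tendsto 0).mono_left nhdsWithin_le_nhds
  have hexp (ε : ℝ) (ν : Fin d → ℝ) : dotR (p + ε • u) ν = dotR p ν + ε * dotR ν u := by
    rw [dotR_comm ν u]
    simp [dotR_eq_dotProduct, add_dotProduct, smul_dotProduct]
  have hin : ∀ᶠ ε : ℝ in 𝓝[>] 0, p + (2 * ε) • u ∈ Q :=
    (hlim 2).eventually (mem_interior_iff_mem_nhds.1 hpi)
  have hev : ∀ᶠ ε : ℝ in 𝓝[>] 0, ∀ ν ∈ {ν : Fin d → ℤ | -2 < MinP Q (intVec ν) - dotR p (intVec ν)},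
      ν ≠ 0 → MinP Q (intVec ν) + 1 ≤ dotR (p + ε • u) (intVec ν) := by
    rw [eventually_all_finite (finite_setOf_lt_minP_sub hQ hpi (-2))]
    intro ν _
    by_cases hν : ν ∈ tightNormals Q p
    · filter_upwards [self_mem_nhdsWithin] with ε hε hν0
      have h1 : p ∈ fineInt Q := hp ▸ rfl
      have h2 := h1 ν hν0
      have h3 := mul_nonneg (le_of_lt hε) (hu _ (mem_image_of_mem _ hν))
      rw [hexp]
      linarith
    · have hc : Continuous fun x : Fin d → ℝ => dotR x (intVec ν) := by unfold dotR; fun_prop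
      have h1 : MinP Q (intVec ν) + 1 < dotR p (intVec ν) := not_le.1 hν
      filter_upwards [((hc.tendsto p).comp (hlim 1)).eventually_const_lt h1] with ε hε _
      simpa using hε.le
  obtain ⟨ε, ⟨hεQ, hεν⟩, hε⟩ := ((hin.and hev).and self_mem_nhdsWithin).exists
  have hmem : p + ε • u ∈ fineInt Q := by
    intro ν hν0
    by_cases hν : -2 < MinP Q (intVec ν) - dotR p (intVec ν)
    · exact hεν ν hν hν0
    · have h1 := minP_le_dotR hQ hεQ (intVec ν)
      rw [hexp] at h1 ⊢
      linarith
  rw [hp, mem_singleton_iff, add_eq_left, smul_eq_zero] at hmem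
  exact hmem.resolve_left (ne_of_gt hε)

theorem span_eq_top_of_dotR {d : ℕ} {s : Set (Fin d → ℝ)}
    (h : ∀ u, (∀ v ∈ s, 0 ≤ dotR v u) → u = 0) : Submodule.span ℝ s = ⊤ := by
  by_contra hs
  obtain ⟨f, hf, hle⟩ := Submodule.exists_le_ker_of_lt_top _ (lt_top_iff_ne_top.2 hs)
  obtain ⟨u, hu⟩ := exists_dotR_eq f
  have hu0 := h u fun v hv => by
    rw [← hu]
    exact (LinearMap.mem_ker.1 (hle (Submodule.subset_span hv))).ge
  exact hf (LinearMap.ext fun x => by simp [hu, hu0, dotR])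

theorem mem_hull_of_dotR {d : ℕ} {s : Set (Fin d → ℝ)}
    (h : ∀ u, (∀ v ∈ s, 0 ≤ dotR v u) → u = 0) (x : Fin d → ℝ) : x ∈ PointedCone.hull ℝ s := by
  by_contra hx
  have hint : (interior (PointedCone.hull ℝ s : Set (Fin d → ℝ))).Nonempty := by
    rw [(PointedCone.hull ℝ s).convex.interior_nonempty_iff_affineSpan_eq_top,
      AffineSubspace.affineSpan_eq_top_iff_vectorSpan_eq_top_of_nonempty ℝ _ _ ⟨0, zero_mem _⟩,
      eq_top_iff, ← span_eq_top_of_dotR h, Submodule.span_le]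
    intro v hv
    simpa using vsub_mem_vectorSpan ℝ
      (show v ∈ (PointedCone.hull ℝ s : Set _) from PointedCone.subset_hull hv)
      (show (0 : Fin d → ℝ) ∈ (PointedCone.hull ℝ s : Set _) from zero_mem _)
  obtain ⟨f, w, hf, hfs, hfx⟩ := geometric_hahn_banach_of_nonempty_interior
    (PointedCone.hull ℝ s).convex (convex_singleton x)
    (disjoint_singleton_right.2 fun hxi => hx (interior_subset hxi)) hint (singleton_nonempty x)
  obtain ⟨u, hu⟩ := exists_dotR_eq (-f : (Fin d → ℝ) →ₗ[ℝ] ℝ)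
  have hu0 := h u fun v hv => by
    rw [← hu]
    by_contra hneg
    have hfv : 0 < f v := by simpa using hneg
    obtain ⟨n, hn⟩ := exists_nat_gt (w / f v)
    have h1 := hfs ((n : ℝ) • v)
      ((PointedCone.hull ℝ s).smul_mem (Nat.cast_nonneg n) (PointedCone.subset_hull hv))
    rw [map_smul, smul_eq_mul] at h1
    rw [div_lt_iff₀ hfv] at hn
    linarith
  refine hf (ContinuousLinearMap.ext fun y => ?_)
  simpa [hu0, dotR] using hu y

theorem exists_forall_dotR_le (d : ℕ) : ∃ B : ℝ, 1 ≤ B ∧ ∀ (Q : Set (Fin d → ℝ)) (p : Fin d → ℝ),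
    IsCompact Q → p ∈ interior Q → fineInt Q = {p} → ∀ ν ∈ tightNormals Q p, ∀ x ∈ Q,
      |dotR (x - p) (intVec ν)| ≤ B := by
  classical
  obtain ⟨c, hc, H⟩ := exists_pos_forall_le_weight (d + 1)
  refine ⟨max 1 (1 / c), le_max_left _ _, fun Q p hQ hpi hp ν hν x hx => ?_⟩
  have hne : Q.Nonempty := ⟨x, hx⟩
  have hpF : p ∈ fineInt Q := hp ▸ rfl
  have hlow (w : Fin d → ℤ) (hw : w ∈ tightNormals Q p) (z : Fin d → ℝ) (hz : z ∈ Q) :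
      -1 ≤ dotR (z - p) (intVec w) := by
    have h1 := minP_le_dotR hQ hz (intVec w)
    have h2 : dotR p (intVec w) ≤ MinP Q (intVec w) + 1 := hw
    rw [dotR_sub]
    linarith
  rw [abs_le]
  refine ⟨(neg_le_neg (le_max_left _ _)).trans (hlow ν hν x hx), le_max_of_le_right ?_⟩
  obtain ⟨a, has, ha0, hasum⟩ := PointedCone.mem_hull_set.1
    (mem_hull_of_dotR (fun u => eq_zero_of_forall_tightNormals hQ hpi hp) (-intVec ν))
  obtain ⟨T, hT, b, hli, hb, hbsum⟩ :=
    exists_linearIndepOn_conic_combination a.support a fun v _ => ha0 v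
  rw [show ∑ v ∈ a.support, a v • v = -intVec ν from hasum] at hbsum
  have hw (v : T) : ∃ w ∈ tightNormals Q p, intVec w = v := has (hT v.2)
  choose w hwS hwv using hw
  have hcard : Fintype.card (Option T) ≤ d + 1 := by
    have := hli.linearIndependent.fintype_card_le_finrank
    simpa using this
  let A : Option T → ℝ := fun o => o.elim 1 fun v => b v
  let n : Option T → Fin d → ℤ := fun o => o.elim ν w
  have hn (o : Option T) : n o ∈ tightNormals Q p := by
    cases o with
    | none => exact hν
    | some v => exact hwS v
  have hA (o : Option T) : 0 < A o := by
    cases o with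
    | none => exact one_pos
    | some v => exact hb v v.2
  have hbsum' : ∑ v : T, b v • (v : Fin d → ℝ) = -intVec ν := by
    rw [← hbsum, ← Finset.sum_coe_sort T]
  have hAn : ∑ o, A o • intVec (n o) = 0 := by
    simp only [Fintype.sum_option, A, n, Option.elim, hwv, one_smul, hbsum', add_neg_cancel]
  have hW : 0 < ∑ o, A o := Finset.sum_pos (fun o _ => hA o) Finset.univ_nonempty
  have hdotA (z : Fin d → ℝ) : ∑ o, A o * dotR z (intVec (n o)) = 0 := by
    have := congrArg (dotR z) hAn
    simpa [dotR_eq_dotProduct, dotProduct_sum, dotProduct_smul] using this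
  have hmain := H (Option T) (fun o => A o / ∑ o, A o) hcard (fun o => div_pos (hA o) hW)
    (by rw [← Finset.sum_div, div_self hW.ne']) ?_ none
  · rw [show A none = 1 from rfl, le_div_iff₀ hW] at hmain
    have h0 := hdotA (x - p)
    rw [Fintype.sum_option] at h0
    have h1 : ∑ v : T, -A (some v) ≤ ∑ v : T, A (some v) * dotR (x - p) (intVec (n (some v))) :=
      Finset.sum_le_sum fun v _ => by
        have h2 := hlow _ (hn (some v)) x hx
        have h3 := hA (some v)
        nlinarith
    have h4 : ∑ o, A o = 1 + ∑ v : T, A (some v) := Fintype.sum_option _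
    rw [Finset.sum_neg_distrib] at h1
    simp only [A, n, Option.elim] at h0 h1 h4 hmain
    rw [le_div_iff₀ hc]
    nlinarith
  · intro m s hms hsum
    have hy : (∑ o, m o • n o) = 0 := by
      refine eq_zero_of_neg_lt_dotR hne hpF hsum fun z hz => ?_
      have h1 : dotR (z - p) (intVec (∑ o, m o • n o))
          = ∑ o, (m o + s * (A o / ∑ o, A o)) * dotR (z - p) (intVec (n o)) := by
        have h2 : ∑ o, (m o + s * (A o / ∑ o, A o)) * dotR (z - p) (intVec (n o))
            = ∑ o, m o * dotR (z - p) (intVec (n o))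
              + s / (∑ o, A o) * ∑ o, A o * dotR (z - p) (intVec (n o)) := by
          rw [Finset.mul_sum, ← Finset.sum_add_distrib]
          refine Finset.sum_congr rfl fun o _ => ?_
          ring
        have h3 : intVec (∑ o, m o • n o) = ∑ o, (m o : ℝ) • intVec (n o) := by
          ext i
          simp [intVec, Finset.sum_apply]
        rw [h2, hdotA, h3]
        simp [dotR_eq_dotProduct, dotProduct_sum, dotProduct_smul]
      rw [h1, ← Finset.sum_neg_distrib]
      refine Finset.sum_le_sum fun o _ => ?_
      have h2 := hlow _ (hn o) z hz
      have h3 := hms o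
      nlinarith
    have hyR : ∑ o, (m o : ℝ) • intVec (n o) = 0 := by
      ext i
      have := congrFun hy i
      simp only [Finset.sum_apply, Pi.smul_apply, smul_eq_mul, Pi.zero_apply, intVec] at this ⊢
      exact_mod_cast this
    rw [Fintype.sum_option] at hyR
    simp only [n, Option.elim, hwv] at hyR
    have hrel : ∑ v : T, ((m (some v) : ℝ) - m none * b v) • (v : Fin d → ℝ) = 0 := by
      simp only [sub_smul, Finset.sum_sub_distrib, mul_smul, ← Finset.smul_sum, hbsum', smul_neg,
        sub_neg_eq_add]
      rw [add_comm]
      exact hyR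
    have hz := Fintype.linearIndependent_iff.1 hli.linearIndependent _ hrel
    refine ⟨m none * ∑ o, A o, fun o => ?_⟩
    rw [mul_assoc, mul_div_cancel₀ _ hW.ne']
    cases o with
    | none => simp [A]
    | some v => exact sub_eq_zero.1 (hz v)

theorem volume_le_of_abs_dotR_le {d : ℕ} {B : ℝ} (hB : 0 ≤ B) {Q : Set (Fin d → ℝ)}
    {p : Fin d → ℝ} {s : Set (Fin d → ℤ)} (hs : Submodule.span ℝ (intVec '' s) = ⊤)
    (h : ∀ ν ∈ s, ∀ x ∈ Q, |dotR (x - p) (intVec ν)| ≤ B) :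
    volume Q ≤ ENNReal.ofReal ((2 * B) ^ d) := by
  obtain ⟨f, hf, -, hli⟩ := Submodule.exists_fun_fin_finrank_span_eq ℝ (intVec '' s)
  have hrank : Module.finrank ℝ (Submodule.span ℝ (intVec '' s)) = d := by
    rw [hs, finrank_top, Module.finrank_fin_fun]
  choose n hns hnf using hf
  let A : Matrix (Fin d) (Fin d) ℤ := Matrix.of fun i => n (Fin.cast hrank.symm i)
  have hdet : A.det ≠ 0 := by
    have h1 : LinearIndependent ℝ (A.map (Int.cast : ℤ → ℝ)).row := by
      have h2 : (A.map (Int.cast : ℤ → ℝ)).row = f ∘ Fin.cast hrank.symm := by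
        ext i j
        simp [A, ← hnf, intVec]
      rw [h2]
      exact hli.comp _ (Fin.cast_injective _)
    rw [Matrix.linearIndependent_rows_iff_isUnit, Matrix.isUnit_iff_isUnit_det] at h1
    intro h0
    apply h1.ne_zero
    have := Int.cast_det A (R := ℝ)
    rw [← this, h0, Int.cast_zero]
  have hdetR : 1 ≤ |LinearMap.det (Matrix.toLin' (A.map (Int.cast : ℤ → ℝ)))| := by
    rw [LinearMap.det_toLin', ← Int.cast_det]
    exact_mod_cast Int.one_le_abs hdet
  set c : Fin d → ℝ := Matrix.toLin' (A.map (Int.cast : ℤ → ℝ)) p with hc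
  have himg : Matrix.toLin' (A.map (Int.cast : ℤ → ℝ)) '' Q ⊆
      Icc (fun i => c i - B) fun i => c i + B := by
    rintro _ ⟨x, hx, rfl⟩
    have key (i : Fin d) : |Matrix.toLin' (A.map (Int.cast : ℤ → ℝ)) x i - c i| ≤ B := by
      rw [hc, ← Pi.sub_apply, ← map_sub]
      have := h _ (hns (Fin.cast hrank.symm i)) x hx
      rw [dotR_comm] at this
      exact this
    refine ⟨fun i => ?_, fun i => ?_⟩
    · have := (abs_le.1 (key i)).1
      linarith
    · have := (abs_le.1 (key i)).2
      linarith
  calc volume Q = 1 * volume Q := (one_mul _).symm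
    _ ≤ ENNReal.ofReal |LinearMap.det (Matrix.toLin' (A.map (Int.cast : ℤ → ℝ)))| * volume Q := by
        gcongr
        exact ENNReal.one_le_ofReal.2 hdetR
    _ = volume (Matrix.toLin' (A.map (Int.cast : ℤ → ℝ)) '' Q) :=
        (Measure.addHaar_image_linearMap _ _ _).symm
    _ ≤ volume (Icc (fun i => c i - B) fun i => c i + B) := measure_mono himg
    _ = ENNReal.ofReal ((2 * B) ^ d) := by
        rw [Real.volume_Icc_pi]
        simp only [add_sub_sub_cancel, ← two_mul, Finset.prod_const, Finset.card_univ,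
          Fintype.card_fin, ENNReal.ofReal_pow (mul_nonneg zero_le_two hB)]

theorem one_le_of_fineInt_dilate_nonempty {d : ℕ} {P : Set (Fin d → ℝ)} (hP : IsCompact P)
    (hne : P.Nonempty) (hF : FHollow P) {lam : ℝ} (h0 : 0 < lam)
    (h : (fineInt (dilate lam P)).Nonempty) : 1 ≤ lam := by
  by_contra! h1
  obtain ⟨q, hq⟩ := h
  obtain ⟨v, hv⟩ := hne
  have hmem : q + (1 - lam) • v ∈ fineInt P := by
    intro ν hν
    have h2 := hq ν hν
    have h3 : lam * MinP P (intVec ν) ≤ MinP (dilate lam P) (intVec ν) := by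
      refine le_minP ⟨_, mem_image_of_mem _ hv⟩ ?_
      rintro _ ⟨x, hx, rfl⟩
      rw [dotR_eq_dotProduct, smul_dotProduct, smul_eq_mul, ← dotR_eq_dotProduct]
      exact mul_le_mul_of_nonneg_left (minP_le_dotR hP hx _) h0.le
    have h4 := mul_le_mul_of_nonneg_left (minP_le_dotR hP hv (intVec ν)) (sub_nonneg.2 h1.le)
    rw [dotR_eq_dotProduct, add_dotProduct, smul_dotProduct, smul_eq_mul, ← dotR_eq_dotProduct,
      ← dotR_eq_dotProduct]
    linarith
  rw [FHollow] at hF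
  rw [hF] at hmem
  exact hmem

theorem fineInt_dilate_zero {d : ℕ} (hd : 0 < d) {P : Set (Fin d → ℝ)} (hne : P.Nonempty) :
    fineInt (dilate 0 P) = ∅ := by
  have h0 : dilate 0 P = {0} := by simp [dilate, hne]
  have hmin (ν : Fin d → ℝ) : MinP {0} ν = 0 := by simp [MinP, dotR]
  rw [h0, eq_empty_iff_forall_notMem]
  intro x hx
  have hs : (Pi.single ⟨0, hd⟩ 1 : Fin d → ℤ) ≠ 0 := by simp
  have h1 := hx _ hs
  have h2 := hx _ (neg_ne_zero.2 hs)
  rw [hmin] at h1 h2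
  have h3 : dotR x (intVec (-Pi.single ⟨0, hd⟩ 1)) = -dotR x (intVec (Pi.single ⟨0, hd⟩ 1)) := by
    simp [dotR, intVec]
  linarith

open scoped Pointwise

/-- the volumes of `d`-dimensional weakly sporadic F-hollow
lattice polytopes are bounded by a constant `C(d) > 0`. -/
theorem weakly_sporadic_volume_bounded (d : ℕ) (hd : 0 < d) :
    ∃ C : ℝ, 0 < C ∧
      ∀ P : Set (Fin d → ℝ), IsWeaklySporadic P → vol P < C := by
  obtain ⟨B, hB, H⟩ := exists_forall_dotR_le d
  have hB0 : 0 ≤ (2 * B) ^ d := by positivity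
  refine ⟨(2 * B) ^ d + 1, by positivity, ?_⟩
  rintro P ⟨⟨A, -, rfl⟩, hfull, hF, p, hp⟩
  set P : Set (Fin d → ℝ) := convexHull ℝ (A : Set (Fin d → ℝ)) with hPdef
  have hP : IsCompact P := A.finite_toSet.isCompact_convexHull ℝ
  have hconv : Convex ℝ P := convex_convexHull ℝ _
  have hint : (interior P).Nonempty := hconv.interior_nonempty_iff_affineSpan_eq_top.2 hfull
  have hne : P.Nonempty := hint.mono interior_subset
  have hmu : 1 ≤ minMult P := by
    rcases eq_empty_or_nonempty {lam : ℝ | 0 < lam ∧ (fineInt (dilate lam P)).Nonempty} with h | h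
    · have h0 : minMult P = 0 := by rw [minMult, h, Real.sInf_empty]
      rw [h0, fineInt_dilate_zero hd hne] at hp
      exact absurd hp.symm (singleton_ne_empty p)
    · exact le_csInf h fun lam hl => one_le_of_fineInt_dilate_nonempty hP hne hF hl.1 hl.2
  set μ := minMult P
  have hdil : dilate μ P = μ • P := rfl
  have hQ : IsCompact (dilate μ P) := hdil ▸ hP.smul μ
  have hpi : p ∈ interior (dilate μ P) := by
    refine fineInt_subset_interior hQ (hdil ▸ hconv.smul μ) ?_ (hp ▸ rfl)
    rw [hdil, interior_smul₀ (zero_lt_one.trans_le hmu).ne']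
    exact hint.smul_set
  have hvol := volume_le_of_abs_dotR_le (zero_le_one.trans hB)
    (span_eq_top_of_dotR fun u => eq_zero_of_forall_tightNormals hQ hpi hp)
    (H _ p hQ hpi hp)
  rw [hdil, Measure.addHaar_smul, Module.finrank_fin_fun] at hvol
  have hle : volume P ≤ ENNReal.ofReal ((2 * B) ^ d) := by
    refine le_trans ?_ hvol
    calc volume P = 1 * volume P := (one_mul _).symm
      _ ≤ _ := by
        gcongr
        exact ENNReal.one_le_ofReal.2 ((one_le_pow₀ hmu).trans (le_abs_self _))
  calc vol P ≤ (2 * B) ^ d := ENNReal.toReal_le_of_le_ofReal hB0 hle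
    _ < (2 * B) ^ d + 1 := lt_add_one _
end
end

section
/- Let P ⊆ ℝ^d be a d-dimensional rational polytope with Fine interior F(P) = {0}. Define the dual polytope P* := {y ∈ ℝ^d : Min_P(y) ≥ −1}. Then: (a) the origin 0 is the unique lattice point of ℤ^d lying in the topological interior of P*; and (b) S_F(P) = {ν ∈ ℤ^d : Min_P(ν) = −1}, i.e., S_F(P) consists exactly of the lattice points on the boundary ∂P* = {y ∈ ℝ^d : Min_P(y) = −1}. -/
open Set MeasureTheory

noncomputable section

lemma dotR_smul_right {d : ℕ} (t : ℝ) (x y : Fin d → ℝ) :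
    dotR x (t • y) = t * dotR x y := by
  simp only [dotR, Pi.smul_apply, smul_eq_mul, Finset.mul_sum]
  exact Finset.sum_congr rfl fun i _ => by ring

lemma continuous_dotR_right {d : ℕ} (x : Fin d → ℝ) : Continuous (dotR x) := by
  unfold dotR
  fun_prop

lemma convex_le_dotR {d : ℕ} (c : ℝ) (y : Fin d → ℝ) :
    Convex ℝ {x : Fin d → ℝ | c ≤ dotR x y} := by
  refine convex_halfSpace_ge (f := fun x => dotR x y) ⟨fun a b => ?_, fun t a => ?_⟩ c
  · simp [dotR, add_mul, Finset.sum_add_distrib]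
  · simp [dotR, Finset.mul_sum, mul_assoc]

lemma minP_smul {d : ℕ} (P : Set (Fin d → ℝ)) {t : ℝ} (ht : 0 ≤ t) (y : Fin d → ℝ) :
    MinP P (t • y) = t * MinP P y := by
  rw [MinP, MinP, ← smul_eq_mul t, ← Real.sInf_smul_of_nonneg ht, ← Set.image_smul,
    Set.image_image]
  simp only [dotR_smul_right, smul_eq_mul]

lemma minP_singleton_zero {d : ℕ} (y : Fin d → ℝ) : MinP {(0 : Fin d → ℝ)} y = 0 := by
  simp [MinP, dotR]

/-- The origin is interior to the dual of the convex hull of a finite set. -/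
lemma zero_mem_interior_dual {d : ℕ} (A : Finset (Fin d → ℝ)) :
    (0 : Fin d → ℝ) ∈
      interior {y : Fin d → ℝ | -1 ≤ MinP (convexHull ℝ (A : Set (Fin d → ℝ))) y} := by
  rw [mem_interior_iff_mem_nhds]
  have h : ∀ᶠ y in nhds (0 : Fin d → ℝ), ∀ a ∈ A, -1 < dotR a y := by
    rw [Filter.eventually_all_finset]
    intro a _
    exact (continuous_dotR_right a).continuousAt.eventually_const_lt (by simp [dotR])
  filter_upwards [h] with y hy
  have hsub : convexHull ℝ (A : Set (Fin d → ℝ)) ⊆ {x | -1 ≤ dotR x y} :=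
    convexHull_min (fun a ha => (hy a ha).le) (convex_le_dotR _ _)
  rcases (convexHull ℝ (A : Set (Fin d → ℝ))).eq_empty_or_nonempty with he | hne
  · simp [MinP, he]
  · exact le_csInf (hne.image _) (by rintro _ ⟨x, hx, rfl⟩; exact hsub hx)

/-- Points in the interior of the dual have minimum strictly above `-1`. -/
lemma neg_one_lt_minP_of_mem_interior {d : ℕ} {P : Set (Fin d → ℝ)} {y : Fin d → ℝ}
    (hy : y ∈ interior {y : Fin d → ℝ | -1 ≤ MinP P y}) : -1 < MinP P y := by
  have hc : ContinuousAt (fun t : ℝ => t • y) 1 := by fun_prop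
  have hev : ∀ᶠ t : ℝ in nhds 1, -1 ≤ MinP P (t • y) :=
    hc.eventually_mem (by simpa using mem_interior_iff_mem_nhds.1 hy)
  obtain ⟨t, ht, h1⟩ :=
    ((hev.filter_mono nhdsWithin_le_nhds).and (self_mem_nhdsWithin (s := Set.Ioi (1 : ℝ)))).exists
  have h1 : 1 < t := h1
  rw [minP_smul P (by linarith)] at ht
  nlinarith

/-- If `F(P) = {0}` then `0` is the unique interior lattice point
of the dual polytope `P* = {y : Min_P(y) ≥ −1}`, and `S_F(P)` consists exactly
of the lattice points `ν` with `Min_P(ν) = −1`. -/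
theorem dual_polytope_canonical (d : ℕ) (P : Set (Fin d → ℝ))
    (hP : IsRatPolytope P) (hfull : IsFullDim P)
    (hF : fineInt P = {(0 : Fin d → ℝ)}) :
    interior {y : Fin d → ℝ | -1 ≤ MinP P y} ∩ latticePts d = {0} ∧
    suppF P = {ν : Fin d → ℤ | MinP P (intVec ν) = -1} := by
  constructor
  · ext y
    simp only [Set.mem_inter_iff, Set.mem_singleton_iff]
    constructor
    · rintro ⟨hy, ν, rfl⟩
      by_contra hne
      have hν : ν ≠ 0 := by
        rintro rfl
        exact hne (by ext i; simp [intVec])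
      have h0 : (0 : Fin d → ℝ) ∈ fineInt P := by simp [hF]
      have h1 := h0 ν hν
      have h2 := neg_one_lt_minP_of_mem_interior hy
      simp only [dotR, Pi.zero_apply, zero_mul, Finset.sum_const_zero] at h1
      linarith
    · rintro rfl
      obtain ⟨A, -, rfl⟩ := hP
      exact ⟨zero_mem_interior_dual A, 0, by ext i; simp [intVec]⟩
  · ext ν
    simp only [suppF, hF, minP_singleton_zero, Set.mem_ofPred_eq]
    constructor <;> intro h <;> linarith
end
end

section
/- A 2-dimensional lattice polytope P ⊆ ℝ² is a sporadic F-hollow lattice polytope if and only if P is unimodular equivalent to the triangle conv{(0,0), (2,0), (0,2)}. -/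
open Set MeasureTheory

noncomputable section

/-- The predicate `K` on `ℤ²`, written in the affine coordinates with origin `(x₀, y₀)` and
basis vectors `(p, r)`, `(q, s)`. -/
def affinePull (K : ℤ → ℤ → Prop) (x₀ y₀ p q r s : ℤ) : ℤ → ℤ → Prop :=
  fun i j => K (x₀ + i * p + j * q) (y₀ + i * r + j * s)

/-- A lattice-convex set of lattice points of the plane, of lattice width at least two in every
direction, such that for every lattice point of the plane some nonzero integral linear form attains
on the set only values at least as large as its value at that point. -/
structure IsWideHollow (K : ℤ → ℤ → Prop) : Prop where
  conv : ∀ {x₁ y₁ x₂ y₂ x₃ y₃ : ℤ} (α β γ : ℤ) {x y : ℤ}, K x₁ y₁ → K x₂ y₂ → K x₃ y₃ →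
    0 ≤ α → 0 ≤ β → 0 ≤ γ → 0 < α + β + γ →
    (α + β + γ) * x = α * x₁ + β * x₂ + γ * x₃ →
    (α + β + γ) * y = α * y₁ + β * y₂ + γ * y₃ → K x y
  hollow : ∀ x y : ℤ, ∃ a b : ℤ, (a ≠ 0 ∨ b ≠ 0) ∧ ∀ s t, K s t → a * x + b * y ≤ a * s + b * t
  wide : ∀ a b : ℤ, IsCoprime a b →
    ∃ s t s' t', K s t ∧ K s' t' ∧ a * s + b * t + 2 ≤ a * s' + b * t'

/-- In suitable unimodular coordinates, `K` contains the vertices of the triangle with vertices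
`(0, 0)`, `(2, 0)`, `(0, 2)` and is contained in that triangle. -/
def IsDoubleTriangle (K : ℤ → ℤ → Prop) : Prop :=
  ∃ x₀ y₀ p q r s : ℤ, (p * s - q * r) ^ 2 = 1 ∧
    affinePull K x₀ y₀ p q r s 0 0 ∧ affinePull K x₀ y₀ p q r s 2 0 ∧
    affinePull K x₀ y₀ p q r s 0 2 ∧
    ∀ i j, affinePull K x₀ y₀ p q r s i j → 0 ≤ i ∧ 0 ≤ j ∧ i + j ≤ 2

theorem exists_affine_coords (x₀ y₀ : ℤ) {p q r s : ℤ} (hd : (p * s - q * r) ^ 2 = 1) (X Y : ℤ) :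
    ∃ i j : ℤ, X = x₀ + i * p + j * q ∧ Y = y₀ + i * r + j * s :=
  ⟨(p * s - q * r) * (s * (X - x₀) - q * (Y - y₀)),
    (p * s - q * r) * (p * (Y - y₀) - r * (X - x₀)),
    by linear_combination (x₀ - X) * hd, by linear_combination (y₀ - Y) * hd⟩

theorem IsWideHollow.pull {K : ℤ → ℤ → Prop} (hK : IsWideHollow K) (x₀ y₀ : ℤ)
    {p q r s : ℤ} (hd : (p * s - q * r) ^ 2 = 1) :
    IsWideHollow (affinePull K x₀ y₀ p q r s) where
  conv α β γ _ _ h₁ h₂ h₃ hα hβ hγ hs hx hy :=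
    hK.conv α β γ h₁ h₂ h₃ hα hβ hγ hs (by linear_combination p * hx + q * hy)
      (by linear_combination r * hx + s * hy)
  hollow x y := by
    obtain ⟨a, b, hab, h⟩ := hK.hollow (x₀ + x * p + y * q) (y₀ + x * r + y * s)
    refine ⟨a * p + b * r, a * q + b * s, ?_, fun i j hij => ?_⟩
    · by_contra! h0
      obtain ⟨h1, h2⟩ := h0
      have ha : a = 0 := by
        linear_combination (p * s - q * r) * (s * h1 - r * h2) - a * hd
      have hb : b = 0 := by
        linear_combination (p * s - q * r) * (p * h2 - q * h1) - b * hd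
      exact hab.elim (fun h => h ha) (fun h => h hb)
    · have := h _ _ hij
      linarith
  wide a' b' hab := by
    obtain ⟨u, v, huv⟩ := hab
    obtain ⟨a, b, ha, hb⟩ := exists_affine_coords 0 0 (p := p) (q := r) (r := q) (s := s)
      (by linear_combination hd) a' b'
    obtain ⟨X, Y, X', Y', h, h', hw⟩ := hK.wide a b
      ⟨u * p + v * q, u * r + v * s, by rw [ha, hb] at huv; linear_combination huv⟩
    obtain ⟨i, j, rfl, rfl⟩ := exists_affine_coords x₀ y₀ hd X Y
    obtain ⟨i', j', rfl, rfl⟩ := exists_affine_coords x₀ y₀ hd X' Y'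
    refine ⟨i, j, i', j', h, h', ?_⟩
    rw [ha, hb]
    linarith

theorem IsDoubleTriangle.of_affinePull {K : ℤ → ℤ → Prop} {x₀ y₀ p q r s : ℤ}
    (hd : (p * s - q * r) ^ 2 = 1) (h : IsDoubleTriangle (affinePull K x₀ y₀ p q r s)) :
    IsDoubleTriangle K := by
  obtain ⟨x₁, y₁, p', q', r', s', hd', h0, h1, h2, hT⟩ := h
  have key : ∀ i j, affinePull K (x₀ + x₁ * p + y₁ * q) (y₀ + x₁ * r + y₁ * s)
      (p' * p + r' * q) (q' * p + s' * q) (p' * r + r' * s) (q' * r + s' * s) i j ↔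
      affinePull (affinePull K x₀ y₀ p q r s) x₁ y₁ p' q' r' s' i j := by
    intro i j
    simp only [affinePull]
    ring_nf
  refine ⟨_, _, _, _, _, _, ?_, (key _ _).2 h0, (key _ _).2 h1, (key _ _).2 h2,
    fun i j hij => hT i j ((key i j).1 hij)⟩
  linear_combination (p' * s' - q' * r') ^ 2 * hd + hd'

namespace IsWideHollow

variable {K : ℤ → ℤ → Prop}

theorem isDoubleTriangle_of_nonneg (hK : IsWideHollow K) (h0 : K 0 0) (h2 : K 2 0)
    (hpos : ∀ s t, K s t → 0 ≤ t) : IsDoubleTriangle K := by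
  obtain ⟨t, h, hth, hh⟩ : ∃ t h, K t h ∧ 2 ≤ h := by
    obtain ⟨s, t, s', t', hs, hs', hw⟩ := hK.wide 0 1 isCoprime_one_right
    exact ⟨s', t', hs', by have := hpos _ _ hs; linarith⟩
  -- no lattice point lies strictly inside the section at height one
  have hsec : ∀ k : ℤ, ¬ (t < h * k ∧ h * k < t + 2 * (h - 1)) := by
    rintro k ⟨hk1, hk2⟩
    obtain ⟨a, b, hab, hs⟩ := hK.hollow k 1
    have e1 := hs _ _ h0
    have e2 := hs _ _ h2
    have e3 := hs _ _ hth
    -- barycentric coordinates of `(k, 1)`, scaled by `2 h`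
    have w1 : 0 < t + 2 * (h - 1) - h * k := by linarith
    have w2 : 0 < h * k - t := by linarith
    have hsum : (t + 2 * (h - 1) - h * k) * (a * 0 + b * 0 - (a * k + b * 1))
      + (h * k - t) * (a * 2 + b * 0 - (a * k + b * 1))
      + 2 * (a * t + b * h - (a * k + b * 1)) = 0 := by ring
    have n1 := mul_nonneg w1.le (sub_nonneg.2 e1)
    have n2 := mul_nonneg w2.le (sub_nonneg.2 e2)
    have z1 : (t + 2 * (h - 1) - h * k) * (a * 0 + b * 0 - (a * k + b * 1)) = 0 := by linarith
    have z2 : (h * k - t) * (a * 2 + b * 0 - (a * k + b * 1)) = 0 := by linarith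
    have z1' := (mul_eq_zero.1 z1).resolve_left w1.ne'
    have z2' := (mul_eq_zero.1 z2).resolve_left w2.ne'
    have ha : a = 0 := by linarith
    subst ha
    have hb : b = 0 := by linarith
    simp [hb] at hab
  have hdm := Int.emod_add_mul_ediv t h
  have hm0 := Int.emod_nonneg t (show h ≠ 0 by omega)
  have hm1 := Int.emod_lt_of_pos t (show 0 < h by omega)
  have hs1 := hsec (t / h + 1)
  rw [mul_add, mul_one] at hs1
  obtain ⟨rfl, m, rfl⟩ : h = 2 ∧ ∃ m, t = 2 * m := by
    have h3 : h = 2 := by omega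
    subst h3
    exact ⟨rfl, t / 2, by omega⟩
  refine ⟨0, 0, 1, m, 0, 1, by norm_num, by simpa [affinePull], by simpa [affinePull], ?_, ?_⟩
  · simpa [affinePull, mul_comm] using hth
  · intro i j hij
    obtain ⟨a, b, hab, hl⟩ := hK.hollow m 1
    obtain ⟨a', b', hab', hr⟩ := hK.hollow (m + 1) 1
    have l1 := hl _ _ h0
    have l2 := hl _ _ h2
    have l3 := hl _ _ hth
    have l4 := hl _ _ hij
    have r1 := hr _ _ h0
    have r2 := hr _ _ h2
    have r3 := hr _ _ hth
    have r4 := hr _ _ hij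
    have hj := hpos _ _ hij
    have hb : b = - a * m := by linarith
    have hb' : b' = a' * (1 - m) := by linarith
    subst hb hb'
    have ha : 0 < a := by
      refine lt_of_le_of_ne (by linarith) ?_
      rintro rfl
      simp at hab
    have ha' : a' < 0 := by
      refine lt_of_le_of_ne (by linarith) ?_
      rintro rfl
      simp at hab'
    refine ⟨?_, by linarith, ?_⟩
    · have : 0 ≤ a * i := by linarith
      exact nonneg_of_mul_nonneg_right this ha
    · have : 0 ≤ (-a') * (2 - (i + j)) := by linarith
      have := nonneg_of_mul_nonneg_right this (by linarith)
      linarith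

theorem isDoubleTriangle_of_two_le (hK : IsWideHollow K) {g : ℤ} (hg : 2 ≤ g) (h0 : K 0 0)
    (hKg : K g 0) : IsDoubleTriangle K := by
  have h2 : K 2 0 := hK.conv (g - 2) 2 0 h0 hKg h0 (by linarith) (by norm_num) le_rfl
    (by linarith) (by ring) (by ring)
  obtain ⟨a, b, hab, h⟩ := hK.hollow 1 0
  have e0 := h _ _ h0
  have e2 := h _ _ h2
  obtain rfl : a = 0 := by linarith
  rcases lt_or_gt_of_ne (show b ≠ 0 by simpa using hab) with hb | hb
  · have hd : ((1 : ℤ) * (-1) - 0 * 0) ^ 2 = 1 := by norm_num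
    refine .of_affinePull (x₀ := 0) (y₀ := 0) hd
      ((hK.pull 0 0 hd).isDoubleTriangle_of_nonneg ?_ ?_ fun s t hst => ?_)
    · simpa [affinePull]
    · simpa [affinePull]
    · have := h _ _ hst
      nlinarith
  · refine hK.isDoubleTriangle_of_nonneg h0 h2 fun s t hst => ?_
    have := h _ _ hst
    nlinarith

/-- Two distinct points of `K` can be moved to the first coordinate axis. -/
theorem exists_affinePull_axis {x y x' y' : ℤ} (hne : x ≠ x' ∨ y ≠ y') (h : K x y)
    (h' : K x' y') : ∃ g p q r s : ℤ, 1 ≤ g ∧ x' - x = g * p ∧ y' - y = g * r ∧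
      (p * s - q * r) ^ 2 = 1 ∧ affinePull K x y p q r s 0 0 ∧ affinePull K x y p q r s g 0 := by
  have hg : 0 < Int.gcd (x' - x) (y' - y) := by
    rw [Int.gcd_pos_iff]
    omega
  obtain ⟨p, hp⟩ := Int.gcd_dvd_left (x' - x) (y' - y)
  obtain ⟨r, hr⟩ := Int.gcd_dvd_right (x' - x) (y' - y)
  have hbez := Int.gcd_eq_gcd_ab (x' - x) (y' - y)
  set g : ℤ := (Int.gcd (x' - x) (y' - y) : ℤ) with hgdef
  have hg' : 0 < g := by rw [hgdef]; exact_mod_cast hg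
  set u := Int.gcdA (x' - x) (y' - y)
  set v := Int.gcdB (x' - x) (y' - y)
  have hone : p * u + r * v = 1 := by
    have : g * (p * u + r * v) = g * 1 := by
      rw [hp, hr] at hbez
      linarith
    exact mul_left_cancel₀ hg'.ne' this
  refine ⟨g, p, -v, r, u, hg', hp, hr, ?_, by simpa [affinePull], ?_⟩
  · rw [show p * u - -v * r = 1 by linarith]
    norm_num
  · have e1 : x + g * p = x' := by linarith
    have e2 : y + g * r = y' := by linarith
    simpa [affinePull, e1, e2]

theorem eq_of_emod_two_eq (hK : IsWideHollow K) (hn : ¬ IsDoubleTriangle K) {x y x' y' : ℤ}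
    (h : K x y) (h' : K x' y') (hx : x % 2 = x' % 2) (hy : y % 2 = y' % 2) :
    x = x' ∧ y = y' := by
  by_contra! hne
  obtain ⟨g, p, q, r, s, hg, hp, hr, hd, h0, h1⟩ :=
    exists_affinePull_axis (by by_cases hxx : x = x' <;> simp_all) h h'
  refine hn (.of_affinePull hd ((hK.pull x y hd).isDoubleTriangle_of_two_le ?_ h0 h1))
  by_contra hlt
  obtain rfl : g = 1 := by omega
  have hp2 : p % 2 = 0 := by omega
  have hr2 : r % 2 = 0 := by omega
  obtain ⟨m, rfl⟩ := Int.dvd_of_emod_eq_zero hp2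
  obtain ⟨n, rfl⟩ := Int.dvd_of_emod_eq_zero hr2
  have : 2 * (2 * (m * s - q * n) ^ 2) = 1 := by linarith
  omega

theorem isDoubleTriangle_of_unimodular (hK : IsWideHollow K) (h0 : K 0 0) (h1 : K 1 0)
    (h2 : K 0 1) : IsDoubleTriangle K := by
  by_contra hn
  have huniq := fun {x y x' y' : ℤ} => hK.eq_of_emod_two_eq hn (x := x) (y := y) (x' := x')
    (y' := y')
  have hodd : ∀ x y, K x y → (x = 0 ∧ y = 0) ∨ (x = 1 ∧ y = 0) ∨ (x = 0 ∧ y = 1) ∨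
      (x % 2 = 1 ∧ y % 2 = 1) := by
    intro x y hxy
    rcases Int.emod_two_eq_zero_or_one x with hx | hx <;>
      rcases Int.emod_two_eq_zero_or_one y with hy | hy
    · exact .inl (huniq hxy h0 hx hy)
    · exact .inr (.inr (.inl (huniq hxy h2 hx hy)))
    · exact .inr (.inl (huniq hxy h1 hx hy))
    · exact .inr (.inr (.inr ⟨hx, hy⟩))
  obtain ⟨x, y, hxy, hx, hxo, hyo⟩ :
      ∃ x y, K x y ∧ (2 ≤ x ∨ x ≤ -1) ∧ x % 2 = 1 ∧ y % 2 = 1 := by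
    obtain ⟨s, t, s', t', hs, hs', hw⟩ := hK.wide 1 0 isCoprime_one_left
    have a1 := hodd _ _ hs
    have a2 := hodd _ _ hs'
    by_cases hlt : s ≤ -1
    · exact ⟨s, t, hs, .inr hlt, by omega, by omega⟩
    · exact ⟨s', t', hs', .inl (by omega), by omega, by omega⟩
  have hcases : x = -1 ∧ y = 1 := by
    rcases lt_or_ge x 0 with hx0 | hx0 <;> rcases lt_or_ge y 0 with hy0 | hy0
    · obtain ⟨a, b, hab, h⟩ := hK.hollow 0 0
      have e1 := h _ _ h1
      have e2 := h _ _ h2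
      have e3 := h _ _ hxy
      have hA : 0 ≤ a * -x := mul_nonneg (by linarith) (by linarith)
      have hB : 0 ≤ b * -y := mul_nonneg (by linarith) (by linarith)
      have hA' : a * x = 0 := by linarith
      have hB' : b * y = 0 := by linarith
      rcases hab with ha | hb
      · exact absurd ((mul_eq_zero.1 hA').resolve_left ha) hx0.ne
      · exact absurd ((mul_eq_zero.1 hB').resolve_left hb) hy0.ne
    · rcases le_or_gt (x + y) 0 with hs | hs
      · have : K (-1) 1 := hK.conv 1 (-x - y) (y - 1) hxy h2 h0 (by norm_num) (by linarith)
          (by omega) (by linarith) (by ring) (by ring)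
        exact huniq hxy this (by omega) (by omega)
      · obtain ⟨a, b, hab, h⟩ := hK.hollow 0 1
        have e1 := h _ _ h0
        have e2 := h _ _ h1
        have e3 := h _ _ hxy
        have hA : 0 ≤ (a - b) * -x := mul_nonneg (by linarith) (by linarith)
        have hB : 0 ≤ -b * (x + y - 1) := mul_nonneg (by linarith) (by linarith)
        have hA' : (a - b) * x = 0 := by linarith
        have hB' : b * (x + y - 1) = 0 := by linarith
        have hb := (mul_eq_zero.1 hB').resolve_right (by omega)
        have ha := (mul_eq_zero.1 hA').resolve_right hx0.ne
        omega
    · rcases le_or_gt (x + y) 0 with hs | hs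
      · have : K 1 (-1) := hK.conv 1 (-x - y) (x - 1) hxy h1 h0 (by norm_num) (by linarith)
          (by omega) (by linarith) (by ring) (by ring)
        have := huniq hxy this (by omega) (by omega)
        omega
      · obtain ⟨a, b, hab, h⟩ := hK.hollow 1 0
        have e1 := h _ _ h0
        have e2 := h _ _ h2
        have e3 := h _ _ hxy
        have hA : 0 ≤ (b - a) * -y := mul_nonneg (by linarith) (by linarith)
        have hB : 0 ≤ -a * (x + y - 1) := mul_nonneg (by linarith) (by linarith)
        have hA' : (b - a) * y = 0 := by linarith
        have hB' : a * (x + y - 1) = 0 := by linarith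
        have hb := (mul_eq_zero.1 hB').resolve_right (by omega)
        have ha := (mul_eq_zero.1 hA').resolve_right hy0.ne
        omega
    · have : K 1 1 := by
        rcases le_total x y with hle | hle
        · exact hK.conv 1 (y - x) (x - 1) hxy h1 h0 (by norm_num) (by linarith)
            (by omega) (by omega) (by ring) (by ring)
        · exact hK.conv 1 (x - y) (y - 1) hxy h2 h0 (by norm_num) (by linarith)
            (by omega) (by omega) (by ring) (by ring)
      have := huniq hxy this (by omega) (by omega)
      omega
  obtain ⟨rfl, rfl⟩ := hcases
  have hrange : ∀ s t, K s t → 0 ≤ t ∧ t ≤ 1 := by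
    intro s t hst
    rcases hodd _ _ hst with h | h | h | h
    · omega
    · omega
    · omega
    · have := huniq hst hxy (by omega) (by omega)
      omega
  obtain ⟨s, t, s', t', hs, hs', hw⟩ := hK.wide 0 1 isCoprime_one_right
  have := hrange _ _ hs
  have := hrange _ _ hs'
  omega

theorem isDoubleTriangle_of_unit_segment (hK : IsWideHollow K) (h0 : K 0 0) (h1 : K 1 0) :
    IsDoubleTriangle K := by
  obtain ⟨t, h, hth, hh⟩ : ∃ t h, K t h ∧ h ≠ 0 := by
    obtain ⟨s, t, s', t', hs, hs', hw⟩ := hK.wide 0 1 isCoprime_one_right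
    by_cases ht : t = 0
    · exact ⟨s', t', hs', by omega⟩
    · exact ⟨s, t, hs, ht⟩
  obtain ⟨ε, n, hε, hn, rfl⟩ : ∃ ε n : ℤ, ε ^ 2 = 1 ∧ 0 < n ∧ h = ε * n := by
    rcases lt_or_gt_of_ne hh with hlt | hlt
    · exact ⟨-1, -h, by norm_num, by omega, by ring⟩
    · exact ⟨1, h, by norm_num, hlt, by ring⟩
  have hdm := Int.emod_add_mul_ediv (-t) n
  have hm0 := Int.emod_nonneg (-t) hn.ne'
  have hm1 := Int.emod_lt_of_pos (-t) hn
  have hu : K (-(-t / n)) ε := hK.conv 1 (-t % n) (n - 1 - -t % n) hth h1 h0 (by norm_num) hm0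
    (by omega) (by omega) (by linear_combination -hdm) (by ring)
  have hd : (1 * ε - -(-t / n) * 0) ^ 2 = 1 := by linear_combination hε
  refine .of_affinePull (x₀ := 0) (y₀ := 0) hd
    ((hK.pull 0 0 hd).isDoubleTriangle_of_unimodular ?_ ?_ ?_)
  · simpa [affinePull]
  · simpa [affinePull]
  · simpa [affinePull] using hu

theorem isDoubleTriangle (hK : IsWideHollow K) : IsDoubleTriangle K := by
  obtain ⟨x, y, x', y', h, h', hw⟩ := hK.wide 0 1 isCoprime_one_right
  obtain ⟨g, p, q, r, s, hg, -, -, hd, h0, hg0⟩ :=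
    exists_affinePull_axis (.inr (by omega : y ≠ y')) h h'
  refine .of_affinePull (x₀ := x) (y₀ := y) hd ?_
  rcases hg.eq_or_lt with rfl | hg
  · exact (hK.pull x y hd).isDoubleTriangle_of_unit_segment h0 hg0
  · exact (hK.pull x y hd).isDoubleTriangle_of_two_le hg h0 hg0

end IsWideHollow

section Polytope

variable {d k : ℕ} {P : Set (Fin d → ℝ)}

theorem isLinearMap_dotR (ν : Fin d → ℝ) : IsLinearMap ℝ fun x : Fin d → ℝ => dotR x ν :=
  ⟨fun x y => add_dotProduct x y ν, fun c x => smul_dotProduct c x ν⟩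

theorem IsLatticePolytope.convex (hP : IsLatticePolytope P) : Convex ℝ P := by
  obtain ⟨A, -, rfl⟩ := hP
  exact convex_convexHull ℝ _

theorem IsFullDim.nonempty (h : IsFullDim P) : P.Nonempty := by
  rw [← affineSpan_nonempty ℝ, h]
  exact ⟨0, trivial⟩

theorem IsLatticePolytope.exists_minimizer (hP : IsLatticePolytope P) (hne : P.Nonempty)
    (ν : Fin d → ℝ) : ∃ c : Fin d → ℤ, intVec c ∈ P ∧ ∀ x ∈ P, dotR (intVec c) ν ≤ dotR x ν := by
  obtain ⟨A, hA, rfl⟩ := hP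
  obtain ⟨m, hm, hmin⟩ := A.exists_min_image (fun x => dotR x ν)
    (by simpa using convexHull_nonempty_iff.1 hne)
  obtain ⟨c, rfl⟩ := hA hm
  exact ⟨c, subset_convexHull ℝ _ hm, fun x hx =>
    convexHull_min (t := {x | dotR (intVec c) ν ≤ dotR x ν}) hmin
      (convex_halfSpace_ge (isLinearMap_dotR ν) _) hx⟩

theorem IsLatticePolytope.minP_le (hP : IsLatticePolytope P) {x : Fin d → ℝ} (hx : x ∈ P)
    (ν : Fin d → ℝ) : MinP P ν ≤ dotR x ν := by
  obtain ⟨c, -, hc⟩ := hP.exists_minimizer ⟨x, hx⟩ ν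
  refine csInf_le ⟨dotR (intVec c) ν, ?_⟩ ⟨x, hx, rfl⟩
  rintro _ ⟨y, hy, rfl⟩
  exact hc y hy

theorem le_minP_s19 (hne : P.Nonempty) {ν : Fin d → ℝ} {m : ℝ} (h : ∀ x ∈ P, m ≤ dotR x ν) :
    m ≤ MinP P ν := by
  refine le_csInf (hne.image _) ?_
  rintro _ ⟨y, hy, rfl⟩
  exact h y hy

theorem IsLatticePolytope.image (hP : IsLatticePolytope P)
    {π : (Fin d → ℝ) →ᵃ[ℝ] (Fin k → ℝ)} (hπ : IsLatticeProj π) : IsLatticePolytope (π '' P) := by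
  classical
  obtain ⟨A, hA, rfl⟩ := hP
  refine ⟨A.image π, ?_, ?_⟩
  · rw [Finset.coe_image, ← hπ]
    exact image_mono hA
  · rw [Finset.coe_image, AffineMap.image_convexHull]

theorem IsFullDim.image (hP : IsFullDim P) {π : (Fin d → ℝ) →ᵃ[ℝ] (Fin k → ℝ)}
    (hπ : Function.Surjective π) : IsFullDim (π '' P) :=
  π.span_eq_top_of_surjective hπ hP

end Polytope

theorem eq_vec_fin_two {α : Type*} (x : Fin 2 → α) : x = ![x 0, x 1] :=
  funext (Fin.forall_fin_two.2 ⟨rfl, rfl⟩)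

theorem Convex.three_smul_mem {E : Type*} [AddCommGroup E] [Module ℝ E] {S : Set E}
    (hS : Convex ℝ S) {u v w : E} (hu : u ∈ S) (hv : v ∈ S) (hw : w ∈ S) {α β γ : ℝ}
    (hα : 0 ≤ α) (hβ : 0 ≤ β) (hγ : 0 ≤ γ) (h : α + β + γ = 1) :
    α • u + β • v + γ • w ∈ S := by
  have := hS.sum_mem (t := Finset.univ) (w := ![α, β, γ]) (z := ![u, v, w])
    (by simp [Fin.forall_fin_succ, *]) (by simpa [Fin.sum_univ_three] using h)
    (by simp [Fin.forall_fin_succ, *])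
  simpa [Fin.sum_univ_three] using this

theorem dotR_fin_two (x y : Fin 2 → ℝ) : dotR x y = x 0 * y 0 + x 1 * y 1 :=
  Fin.sum_univ_two _

theorem dotR_fin_one (x y : Fin 1 → ℝ) : dotR x y = x 0 * y 0 :=
  Fin.sum_univ_one _

theorem IsSporadic.exists_width_two_le {P : Set (Fin 2 → ℝ)} (hP : IsSporadic P) {a b : ℤ}
    (hab : IsCoprime a b) : ∃ s t s' t' : ℤ, intVec ![s, t] ∈ P ∧ intVec ![s', t'] ∈ P ∧
      a * s + b * t + 2 ≤ a * s' + b * t' := by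
  obtain ⟨hlat, hfull, -, hproj⟩ := hP
  obtain ⟨u, v, huv⟩ := hab
  have huv' : (u * a + v * b : ℝ) = 1 := by exact_mod_cast huv
  let π : (Fin 2 → ℝ) →ᵃ[ℝ] (Fin 1 → ℝ) :=
    (LinearMap.pi fun _ => (a : ℝ) • LinearMap.proj 0 + (b : ℝ) • LinearMap.proj 1 :
      (Fin 2 → ℝ) →ₗ[ℝ] (Fin 1 → ℝ)).toAffineMap
  have hπ : ∀ x, π x 0 = a * x 0 + b * x 1 := fun x => rfl
  have hπlat : IsLatticeProj π := by
    refine Subset.antisymm ?_ ?_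
    · rintro _ ⟨_, ⟨c, rfl⟩, rfl⟩
      refine ⟨fun _ => a * c 0 + b * c 1, funext fun i => ?_⟩
      rw [Subsingleton.elim i 0, hπ]
      simp [intVec]
    · rintro _ ⟨c, rfl⟩
      refine ⟨_, ⟨![u * c 0, v * c 0], rfl⟩, funext fun i => ?_⟩
      rw [Subsingleton.elim i 0, hπ]
      simp only [intVec, Matrix.cons_val_zero, Matrix.cons_val_one, Int.cast_mul]
      linear_combination (c 0 : ℝ) * huv'
  have hπsurj : Function.Surjective π := by
    intro z
    refine ⟨![u * z 0, v * z 0], funext fun i => ?_⟩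
    rw [Subsingleton.elim i 0, hπ]
    simp only [Matrix.cons_val_zero, Matrix.cons_val_one]
    linear_combination z 0 * huv'
  obtain ⟨z, hz⟩ : (fineInt (π '' P)).Nonempty := by
    rw [nonempty_iff_ne_empty]
    exact fun h => hproj
      ⟨1, le_rfl, le_rfl, π, hπlat, hlat.image hπlat, hfull.image hπsurj, h⟩
  have hne := hfull.nonempty
  obtain ⟨c, hc, hcmin⟩ := hlat.exists_minimizer hne ![a, b]
  obtain ⟨c', hc', hcmax⟩ := hlat.exists_minimizer hne ![-a, -b]
  have h1 := hz (fun _ => 1) (fun h => one_ne_zero (congrFun h 0))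
  have h2 := hz (fun _ => -1) (fun h => by simpa using congrFun h 0)
  have h1' : dotR (intVec c) ![a, b] ≤ MinP (π '' P) (intVec fun _ => 1) := by
    refine le_minP_s19 (hne.image _) ?_
    rintro _ ⟨x, hx, rfl⟩
    have := hcmin x hx
    simp only [dotR_fin_one, dotR_fin_two, hπ, intVec, Matrix.cons_val_zero, Matrix.cons_val_one,
      Int.cast_one] at this ⊢
    linarith
  have h2' : dotR (intVec c') ![-a, -b] ≤ MinP (π '' P) (intVec fun _ => -1) := by
    refine le_minP_s19 (hne.image _) ?_
    rintro _ ⟨x, hx, rfl⟩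
    have := hcmax x hx
    simp only [dotR_fin_one, dotR_fin_two, hπ, intVec, Matrix.cons_val_zero, Matrix.cons_val_one,
      Int.cast_one, Int.cast_neg] at this ⊢
    linarith
  rw [eq_vec_fin_two c] at hc
  rw [eq_vec_fin_two c'] at hc'
  refine ⟨c 0, c 1, c' 0, c' 1, hc, hc', ?_⟩
  simp only [dotR_fin_one, dotR_fin_two, intVec, Matrix.cons_val_zero, Matrix.cons_val_one,
    Int.cast_one, Int.cast_neg] at h1 h2 h1' h2'
  have : (a * c 0 + b * c 1 + 2 : ℝ) ≤ a * c' 0 + b * c' 1 := by linarith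
  exact_mod_cast this

theorem IsSporadic.isWideHollow {P : Set (Fin 2 → ℝ)} (hP : IsSporadic P) :
    IsWideHollow fun i j => intVec ![i, j] ∈ P where
  conv {x₁ y₁ x₂ y₂ x₃ y₃} α β γ {x y} h₁ h₂ h₃ hα hβ hγ hs hx hy := by
    have hα' : (0 : ℝ) ≤ α := by exact_mod_cast hα
    have hβ' : (0 : ℝ) ≤ β := by exact_mod_cast hβ
    have hγ' : (0 : ℝ) ≤ γ := by exact_mod_cast hγ
    have hs' : (0 : ℝ) < α + β + γ := by exact_mod_cast hs
    have hx' : ((α + β + γ) * x : ℝ) = α * x₁ + β * x₂ + γ * x₃ := by exact_mod_cast hx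
    have hy' : ((α + β + γ) * y : ℝ) = α * y₁ + β * y₂ + γ * y₃ := by exact_mod_cast hy
    convert hP.1.convex.three_smul_mem h₁ h₂ h₃ (div_nonneg hα' hs'.le) (div_nonneg hβ' hs'.le)
      (div_nonneg hγ' hs'.le) (by field_simp) using 1
    refine funext (Fin.forall_fin_two.2 ⟨?_, ?_⟩)
    · simp [intVec]
      field_simp
      linear_combination hx'
    · simp [intVec]
      field_simp
      linear_combination hy'
  hollow x y := by
    obtain ⟨hlat, -, hF, -⟩ := hP
    have hxy : intVec ![x, y] ∉ fineInt P := by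
      rw [hF]
      exact notMem_empty _
    simp only [fineInt, mem_ofPred_eq, not_forall, not_le] at hxy
    obtain ⟨ν, hν, hlt⟩ := hxy
    refine ⟨ν 0, ν 1, ?_, fun s t hst => ?_⟩
    · by_contra! h
      exact hν (funext (Fin.forall_fin_two.2 h))
    · have := (add_le_add_left (hlat.minP_le hst (intVec ν)) 1).trans_lt' hlt
      simp only [dotR_fin_two, intVec, Matrix.cons_val_zero, Matrix.cons_val_one] at this
      have : x * ν 0 + y * ν 1 < s * ν 0 + t * ν 1 + 1 := by exact_mod_cast this
      linarith
  wide _ _ hab := hP.exists_width_two_le hab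

theorem mem_doubleTriangle {z : Fin 2 → ℝ} :
    z ∈ convexHull ℝ ({![0, 0], ![2, 0], ![0, 2]} : Set (Fin 2 → ℝ)) ↔
      0 ≤ z 0 ∧ 0 ≤ z 1 ∧ z 0 + z 1 ≤ 2 := by
  constructor
  · refine fun hz => convexHull_min (t := {z : Fin 2 → ℝ | 0 ≤ z 0 ∧ 0 ≤ z 1 ∧ z 0 + z 1 ≤ 2}) ?_ ?_ hz
    · rintro _ (rfl | rfl | rfl) <;> simp
    · rintro x ⟨hx0, hx1, hx2⟩ y ⟨hy0, hy1, hy2⟩ a b ha hb hab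
      refine ⟨?_, ?_, ?_⟩
      · exact add_nonneg (mul_nonneg ha hx0) (mul_nonneg hb hy0)
      · exact add_nonneg (mul_nonneg ha hx1) (mul_nonneg hb hy1)
      · simp only [Pi.add_apply, Pi.smul_apply, smul_eq_mul]
        nlinarith [mul_le_mul_of_nonneg_left hx2 ha, mul_le_mul_of_nonneg_left hy2 hb]
  · rintro ⟨h0, h1, h2⟩
    have hsub := subset_convexHull ℝ ({![0, 0], ![2, 0], ![0, 2]} : Set (Fin 2 → ℝ))
    convert (convex_convexHull ℝ _).three_smul_mem (hsub (.inl rfl)) (hsub (.inr (.inl rfl)))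
      (hsub (.inr (.inr rfl))) (α := 1 - z 0 / 2 - z 1 / 2) (β := z 0 / 2) (γ := z 1 / 2)
      (by linarith) (by linarith) (by linarith) (by ring) using 1
    exact funext (Fin.forall_fin_two.2 ⟨by simp, by simp⟩)

/-- The linear automorphism of the plane given by an integer matrix of determinant `±1`. -/
def unimodularEquiv (p q r s : ℤ) (hd : (p * s - q * r) ^ 2 = 1) :
    (Fin 2 → ℝ) ≃ₗ[ℝ] (Fin 2 → ℝ) where
  toFun x := ![x 0 * p + x 1 * q, x 0 * r + x 1 * s]
  invFun x := ![(p * s - q * r) * (s * x 0 - q * x 1), (p * s - q * r) * (p * x 1 - r * x 0)]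
  map_add' x y := funext (Fin.forall_fin_two.2 ⟨by simp; ring, by simp; ring⟩)
  map_smul' c x := funext (Fin.forall_fin_two.2 ⟨by simp; ring, by simp; ring⟩)
  left_inv x := by
    have hd' : (p * s - q * r : ℝ) ^ 2 = 1 := by exact_mod_cast hd
    refine funext (Fin.forall_fin_two.2 ⟨?_, ?_⟩)
    · simp only [Matrix.cons_val_zero, Matrix.cons_val_one]
      linear_combination x 0 * hd'
    · simp only [Matrix.cons_val_zero, Matrix.cons_val_one]
      linear_combination x 1 * hd'
  right_inv x := by
    have hd' : (p * s - q * r : ℝ) ^ 2 = 1 := by exact_mod_cast hd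
    refine funext (Fin.forall_fin_two.2 ⟨?_, ?_⟩)
    · simp only [Matrix.cons_val_zero, Matrix.cons_val_one]
      linear_combination x 0 * hd'
    · simp only [Matrix.cons_val_zero, Matrix.cons_val_one]
      linear_combination x 1 * hd'

theorem unimodEquiv_of_isDoubleTriangle {P : Set (Fin 2 → ℝ)} (hP : IsLatticePolytope P)
    (h : IsDoubleTriangle fun i j => intVec ![i, j] ∈ P) :
    UnimodEquiv P (convexHull ℝ ({![0, 0], ![2, 0], ![0, 2]} : Set (Fin 2 → ℝ))) := by
  obtain ⟨x₀, y₀, p, q, r, s, hd, h0, h1, h2, hT⟩ := h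
  let ψ : (Fin 2 → ℝ) ≃ᵃ[ℝ] (Fin 2 → ℝ) := (unimodularEquiv p q r s hd).toAffineEquiv.trans
    (AffineEquiv.constVAdd ℝ (Fin 2 → ℝ) (intVec ![x₀, y₀]))
  have hψ : ∀ i j : ℤ, ψ (intVec ![i, j]) =
      intVec ![x₀ + i * p + j * q, y₀ + i * r + j * s] := by
    intro i j
    refine funext (Fin.forall_fin_two.2 ⟨?_, ?_⟩) <;>
      simp [ψ, unimodularEquiv, intVec, add_assoc]
  have hlat : ψ '' latticePts 2 = latticePts 2 := by
    refine Subset.antisymm ?_ ?_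
    · rintro _ ⟨_, ⟨c, rfl⟩, rfl⟩
      rw [eq_vec_fin_two c, hψ]
      exact ⟨_, rfl⟩
    · rintro _ ⟨c, rfl⟩
      obtain ⟨i, j, hi, hj⟩ := exists_affine_coords x₀ y₀ hd (c 0) (c 1)
      refine ⟨_, ⟨![i, j], rfl⟩, ?_⟩
      rw [hψ, ← hi, ← hj, ← eq_vec_fin_two]
  have himg : ψ '' convexHull ℝ ({![0, 0], ![2, 0], ![0, 2]} : Set (Fin 2 → ℝ)) = P := by
    refine Subset.antisymm ?_ ?_
    · have hvert : ∀ i j : ℤ, affinePull (fun i j => intVec ![i, j] ∈ P) x₀ y₀ p q r s i j →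
          ψ ![(i : ℝ), (j : ℝ)] ∈ P := by
        intro i j hij
        rw [affinePull, ← hψ] at hij
        convert hij using 2
        exact funext (Fin.forall_fin_two.2 ⟨rfl, rfl⟩)
      rw [image_subset_iff]
      refine convexHull_min ?_ (hP.convex.affine_preimage ψ.toAffineMap)
      rintro _ (rfl | rfl | rfl)
      · simpa using hvert 0 0 h0
      · simpa using hvert 2 0 h1
      · simpa using hvert 0 2 h2
    · obtain ⟨A, hA, rfl⟩ := hP
      refine convexHull_min ?_ ((convex_convexHull ℝ _).affine_image ψ.toAffineMap)
      intro x hx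
      obtain ⟨c, rfl⟩ := hA hx
      have hx' := subset_convexHull ℝ _ hx
      obtain ⟨i, j, hi, hj⟩ := exists_affine_coords x₀ y₀ hd (c 0) (c 1)
      rw [eq_vec_fin_two c, hi, hj] at hx' ⊢
      obtain ⟨hi0, hj0, hij⟩ := hT i j hx'
      refine ⟨intVec ![i, j], mem_doubleTriangle.2 ⟨?_, ?_, ?_⟩, hψ i j⟩
      · simpa [intVec] using hi0
      · simpa [intVec] using hj0
      · simp only [intVec, Matrix.cons_val_zero, Matrix.cons_val_one]
        exact_mod_cast hij
  refine ⟨ψ.symm, ?_, ?_⟩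
  · rw [← hlat, image_image]
    simp [hlat]
  · rw [← himg, image_image]
    simp

theorem exists_int_coeffs {k : ℕ} {f : (Fin 2 → ℝ) →ᵃ[ℝ] (Fin k → ℝ)} (hf : IsLatticeProj f) :
    ∃ c a b : Fin k → ℤ, ∀ y i, f y i = c i + a i * y 0 + b i * y 1 := by
  have hlift : ∀ v : Fin 2 → ℤ, ∃ w : Fin k → ℤ, intVec w = f (intVec v) := fun v => by
    have : f (intVec v) ∈ latticePts k := hf ▸ mem_image_of_mem f ⟨v, rfl⟩
    exact this
  obtain ⟨c, hc⟩ := hlift 0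
  obtain ⟨a, ha⟩ := hlift ![1, 0]
  obtain ⟨b, hb⟩ := hlift ![0, 1]
  refine ⟨c, a - c, b - c, fun y i => ?_⟩
  have hlin : ∀ v, f v = f.linear v + f 0 := fun v => by simpa using f.map_vadd 0 v
  have hy : y = y 0 • intVec ![1, 0] + y 1 • intVec ![0, 1] :=
    funext (Fin.forall_fin_two.2 ⟨by simp [intVec], by simp [intVec]⟩)
  have h0 : intVec (0 : Fin 2 → ℤ) = 0 := funext fun i => by simp [intVec]
  rw [h0] at hc
  have hfy : f y = y 0 • (f (intVec ![1, 0]) - f 0) + y 1 • (f (intVec ![0, 1]) - f 0) + f 0 := by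
    conv_lhs => rw [hlin, hy, map_add, map_smul, map_smul]
    rw [hlin (intVec ![1, 0]), hlin (intVec ![0, 1]), add_sub_cancel_right, add_sub_cancel_right]
  rw [hfy, ← hc, ← ha, ← hb]
  simp only [Pi.add_apply, Pi.smul_apply, Pi.sub_apply, smul_eq_mul, intVec, Int.cast_sub]
  ring

theorem fineInt_nonempty_of_two_mul {S : Set (Fin 1 → ℝ)} (hS : IsLatticePolytope S)
    {x y : Fin 1 → ℝ} (hx : x ∈ S) (hy : y ∈ S) {m : ℤ} (hm : m ≠ 0)
    (hxy : y 0 = x 0 + 2 * m) : (fineInt S).Nonempty := by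
  refine ⟨fun _ => x 0 + m, fun ν hν => ?_⟩
  have hx' := hS.minP_le hx (intVec ν)
  have hy' := hS.minP_le hy (intVec ν)
  rw [dotR_fin_one] at hx' hy' ⊢
  have hν0 : ν 0 ≠ 0 := fun h => hν (funext fun i => by rw [Subsingleton.elim i 0, h]; rfl)
  simp only [intVec] at hx' hy' ⊢
  rcases lt_or_gt_of_ne (mul_ne_zero hm hν0) with h | h
  · have : (m * ν 0 : ℝ) ≤ -1 := by exact_mod_cast (show m * ν 0 ≤ -1 by omega)
    rw [hxy] at hy'
    linarith
  · have : (1 : ℝ) ≤ m * ν 0 := by exact_mod_cast h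
    linarith

theorem UnimodEquiv.fHollow {P : Set (Fin 2 → ℝ)}
    (h : UnimodEquiv P (convexHull ℝ ({![0, 0], ![2, 0], ![0, 2]} : Set (Fin 2 → ℝ)))) :
    FHollow P := by
  obtain ⟨φ, hlat, himg⟩ := h
  obtain ⟨c, a, b, hφ⟩ := exists_int_coeffs (f := φ.toAffineMap) hlat
  replace hφ : ∀ y i, φ y i = c i + a i * y 0 + b i * y 1 := hφ
  have hne : P.Nonempty := by
    rw [← image_nonempty (f := φ), himg]
    exact ⟨0, mem_doubleTriangle.2 (by simp)⟩
  refine eq_empty_of_forall_notMem fun x hx => ?_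
  have key : ∀ u v n : ℤ, (u ≠ 0 ∨ v ≠ 0) →
      (∀ z ∈ convexHull ℝ ({![0, 0], ![2, 0], ![0, 2]} : Set (Fin 2 → ℝ)),
        (n : ℝ) ≤ u * z 0 + v * z 1) → (n : ℝ) + 1 ≤ u * φ x 0 + v * φ x 1 := by
    intro u v n huv hn
    have hν : (![u * a 0 + v * a 1, u * b 0 + v * b 1] : Fin 2 → ℤ) ≠ 0 := by
      intro h0
      have e0 : (u * a 0 + v * a 1 : ℝ) = 0 := by exact_mod_cast congrFun h0 0
      have e1 : (u * b 0 + v * b 1 : ℝ) = 0 := by exact_mod_cast congrFun h0 1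
      obtain ⟨y, hy⟩ := φ.surjective 0
      obtain ⟨y', hy'⟩ := φ.surjective ![(u : ℝ), v]
      have f0 := hφ y 0
      have f1 := hφ y 1
      have g0 := hφ y' 0
      have g1 := hφ y' 1
      simp only [hy, hy', Pi.zero_apply, Matrix.cons_val_zero, Matrix.cons_val_one]
        at f0 f1 g0 g1
      have : (u * u + v * v : ℝ) = 0 := by
        linear_combination (u : ℝ) * (g0 - f0) + v * (g1 - f1) + (y' 0 - y 0) * e0
          + (y' 1 - y 1) * e1
      have : u * u + v * v = 0 := by exact_mod_cast this
      rcases huv with hu | hv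
      · nlinarith [mul_self_pos.2 hu, mul_self_nonneg v]
      · nlinarith [mul_self_pos.2 hv, mul_self_nonneg u]
    have hmin : (n - u * c 0 - v * c 1 : ℝ) ≤
        MinP P (intVec ![u * a 0 + v * a 1, u * b 0 + v * b 1]) := by
      refine le_minP_s19 hne fun y hy => ?_
      have := hn _ (himg ▸ mem_image_of_mem φ hy)
      rw [hφ, hφ] at this
      simp only [dotR_fin_two, intVec, Matrix.cons_val_zero, Matrix.cons_val_one, Int.cast_add,
        Int.cast_mul]
      linarith
    have := hx _ hν
    simp only [dotR_fin_two, intVec, Matrix.cons_val_zero, Matrix.cons_val_one, Int.cast_add,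
      Int.cast_mul] at this hmin
    rw [hφ, hφ]
    linarith
  have k1 := key 1 0 0 (by simp) fun z hz => by simpa using (mem_doubleTriangle.1 hz).1
  have k2 := key 0 1 0 (by simp) fun z hz => by simpa using (mem_doubleTriangle.1 hz).2.1
  have k3 := key (-1) (-1) (-2) (by simp) fun z hz => by
    have := (mem_doubleTriangle.1 hz).2.2
    push_cast
    linarith
  push_cast at k1 k2 k3
  linarith

theorem UnimodEquiv.isSporadic {P : Set (Fin 2 → ℝ)} (hP : IsLatticePolytope P)
    (hfull : IsFullDim P)
    (h : UnimodEquiv P (convexHull ℝ ({![0, 0], ![2, 0], ![0, 2]} : Set (Fin 2 → ℝ)))) :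
    IsSporadic P := by
  refine ⟨hP, hfull, h.fHollow, ?_⟩
  rintro ⟨k, hk, hk', π, hπ, hπP, -, hF⟩
  obtain rfl : k = 1 := by omega
  obtain ⟨φ, hlat, himg⟩ := h
  have hσ : IsLatticeProj (π.comp φ.symm.toAffineMap) := by
    have : φ.symm '' latticePts 2 = latticePts 2 := by
      conv_lhs => rw [← hlat, image_image]
      simp
    rw [IsLatticeProj, AffineMap.coe_comp, image_comp]
    exact (congrArg _ this).trans hπ
  obtain ⟨c, a, b, hform⟩ := exists_int_coeffs hσ
  have hmem : ∀ z ∈ convexHull ℝ ({![0, 0], ![2, 0], ![0, 2]} : Set (Fin 2 → ℝ)),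
      π.comp φ.symm.toAffineMap z ∈ π '' P := by
    intro z hz
    rw [← himg] at hz
    obtain ⟨y, hy, rfl⟩ := hz
    exact ⟨y, hy, by simp⟩
  have m0 := hmem ![0, 0] (mem_doubleTriangle.2 (by simp))
  have hab : a 0 ≠ 0 ∨ b 0 ≠ 0 := by
    by_contra! h0
    have hmem0 : intVec (c + 1) ∈ latticePts 1 := ⟨_, rfl⟩
    rw [← hσ] at hmem0
    obtain ⟨y, -, hy⟩ := hmem0
    have := hform y 0
    rw [hy, h0.1, h0.2] at this
    simp [intVec] at this
  have hne : (fineInt (π '' P)).Nonempty := by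
    rcases hab with ha | hb
    · refine fineInt_nonempty_of_two_mul hπP m0
        (hmem ![2, 0] (mem_doubleTriangle.2 (by simp))) ha ?_
      simp only [hform, Matrix.cons_val_zero, Matrix.cons_val_one]
      ring
    · refine fineInt_nonempty_of_two_mul hπP m0
        (hmem ![0, 2] (mem_doubleTriangle.2 (by simp))) hb ?_
      simp only [hform, Matrix.cons_val_zero, Matrix.cons_val_one]
      ring
  exact hne.ne_empty hF

/-- a 2-dimensional lattice polytope is sporadic F-hollow iff it
is unimodular equivalent to the triangle `conv{(0,0), (2,0), (0,2)}`. -/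
theorem sporadic_dim_two (P : Set (Fin 2 → ℝ))
    (hP : IsLatticePolytope P) (hfull : IsFullDim P) :
    IsSporadic P ↔
      UnimodEquiv P
        (convexHull ℝ ({![0, 0], ![2, 0], ![0, 2]} : Set (Fin 2 → ℝ))) := by
  exact ⟨fun h => unimodEquiv_of_isDoubleTriangle hP h.isWideHollow.isDoubleTriangle,
    fun h => h.isSporadic hP hfull⟩
end
end
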